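/- arXiv:1812.11124 — 4 statements merged into one kernel-verified Lean document; each statement's English description precedes it below -/
import Mathlib

section
/- Assume F is algebraically closed of characteristic different from 2, and let C¹, …, Cⁿ be Cayley algebras over F. Every F-algebra automorphism g of the direct product algebra C¹×…×Cⁿ maps the subspace C¹₀×…×Cⁿ₀ onto itself, and the restriction map g ↦ g|_{C¹₀×…×Cⁿ₀} is a bijective group homomorphism from the automorphism group Aut_F(C¹×…×Cⁿ) onto the automorphism group of the algebra C¹₀×…×Cⁿ₀ equipped with the componentwise commutator product [x,y] := xy − yx. -/
noncomputable section

/-- A Hurwitz algebra structure: `n` is a multiplicative quadratic form whose polar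
form is nondegenerate, on a finite-dimensional unital (not necessarily associative)
`F`-algebra `B`. -/
def IsHurwitz (F : Type*) [Field F] {B : Type*} [NonAssocRing B] [Module F B]
    (n : QuadraticForm F B) : Prop :=
  FiniteDimensional F B ∧
    (∀ x : B, (∀ y : B, QuadraticMap.polar n x y = 0) → x = 0) ∧
    (∀ x y : B, n (x * y) = n x * n y)

/-- The standard conjugation `x ↦ n(x,1)·1 - x` of a Hurwitz algebra, as a linear map. -/
def hconj (F : Type*) [Field F] {B : Type*} [NonAssocRing B] [Module F B]
    (n : QuadraticForm F B) : B →ₗ[F] B where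
  toFun x := QuadraticMap.polar n x 1 • (1 : B) - x
  map_add' x y := by
    simp only [QuadraticMap.polar_add_left, add_smul]
    abel
  map_smul' c x := by
    simp [QuadraticMap.polar_smul_left, smul_sub, mul_smul]

/-- The subspace `B₀ = {x ∈ B : x̄ = -x}` of skew elements of a Hurwitz algebra. -/
def skewPart (F : Type*) [Field F] {B : Type*} [NonAssocRing B] [Module F B]
    (n : QuadraticForm F B) : Submodule F B where
  carrier := {x | hconj F n x = -x}
  add_mem' := by
    intro a b ha hb
    simp only [Set.mem_setOf_eq, map_add] at *
    rw [ha, hb]; abel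
  zero_mem' := by simp
  smul_mem' := by
    intro c x hx
    simp only [Set.mem_setOf_eq, map_smul] at *
    rw [hx, smul_neg]

/-- The subspace `C¹₀ × ⋯ × Cⁿ₀` of the product algebra `C¹ × ⋯ × Cⁿ`. -/
def skewPi (F : Type*) [Field F] {m : ℕ} {C : Fin m → Type*} [∀ i, NonAssocRing (C i)]
    [∀ i, Module F (C i)] (n : ∀ i, QuadraticForm F (C i)) : Submodule F (Π i, C i) :=
  Submodule.pi Set.univ fun i => skewPart F (n i)

namespace IsHurwitz

open QuadraticMap

variable {F : Type*} [Field F] {B : Type*} [NonAssocRing B] [Module F B]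
  {n : QuadraticForm F B}

theorem eq_of_polar (h : IsHurwitz F n) {x y : B} (hxy : ∀ z, polar n x z = polar n y z) :
    x = y := by
  refine sub_eq_zero.mp (h.2.1 _ fun z => ?_)
  rw [polar_sub_left, hxy, sub_self]

theorem map_one [Nontrivial B] (h : IsHurwitz F n) : n 1 = 1 := by
  obtain ⟨x, hx⟩ : ∃ x, n x ≠ 0 := by
    by_contra! hn
    obtain ⟨x, hx⟩ := exists_ne (0 : B)
    exact hx (h.2.1 x fun y => by simp [polar, hn])
  have h1 := h.2.2 x 1
  rw [mul_one] at h1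
  exact mul_left_cancel₀ hx (by rw [← h1, mul_one])

theorem polar_mul_right (h : IsHurwitz F n) (x y z : B) :
    polar n (x * z) (y * z) = polar n x y * n z := by
  simp only [polar, ← add_mul, h.2.2]
  ring

theorem polar_mul_left (h : IsHurwitz F n) (x y z : B) :
    polar n (z * x) (z * y) = n z * polar n x y := by
  simp only [polar, ← mul_add, h.2.2]
  ring

theorem polar_mul_add_polar_mul (h : IsHurwitz F n) (x y z w : B) :
    polar n (x * y) (z * w) + polar n (x * w) (z * y) = polar n x z * polar n y w := by
  have h1 := h.polar_mul_right x z (y + w)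
  rw [mul_add, mul_add, polar_add_left, polar_add_right, polar_add_right,
    h.polar_mul_right, h.polar_mul_right] at h1
  have h2 : polar n y w = n (y + w) - n y - n w := rfl
  rw [h2]
  linear_combination h1

theorem mul_self (h : IsHurwitz F n) (x : B) :
    x * x = polar n x 1 • x - n x • (1 : B) := by
  refine h.eq_of_polar fun z => ?_
  have h1 := h.polar_mul_add_polar_mul x x z 1
  have h2 := h.polar_mul_right 1 z x
  simp only [mul_one, one_mul] at h1 h2
  simp only [polar_sub_left, polar_smul_left, smul_eq_mul]
  linear_combination h1 - h2

theorem mem_skewPart_iff [Nontrivial B] {x : B} :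
    x ∈ skewPart F n ↔ polar n x 1 = 0 := by
  change polar n x 1 • (1 : B) - x = -x ↔ _
  rw [sub_eq_neg_self]
  simp

theorem polar_one_one [Nontrivial B] (h : IsHurwitz F n) : polar n (1 : B) 1 = 2 := by
  rw [polar_self, h.map_one, nsmul_eq_mul, Nat.cast_ofNat, mul_one]

theorem sub_half_mem_skewPart [Nontrivial B] (h : IsHurwitz F n) (hF : (2 : F) ≠ 0) (x : B) :
    x - (2⁻¹ * polar n x 1) • (1 : B) ∈ skewPart F n := by
  rw [mem_skewPart_iff, polar_sub_left, polar_smul_left, h.polar_one_one, smul_eq_mul]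
  field_simp
  ring

theorem commutator_mem_skewPart [Nontrivial B] (h : IsHurwitz F n) (x y : B) :
    x * y - y * x ∈ skewPart F n := by
  rw [mem_skewPart_iff, polar_sub_left]
  have h1 := h.polar_mul_add_polar_mul x y 1 1
  have h2 := h.polar_mul_add_polar_mul y x 1 1
  simp only [mul_one, one_mul] at h1 h2
  linear_combination h1 - h2 - polar_comm n x y

theorem mul_mul_self [Nontrivial B] (h : IsHurwitz F n) (x : B) {y : B}
    (hy : y ∈ skewPart F n) : (x * y) * y = -(n y • x) := by
  refine h.eq_of_polar fun z => ?_
  have h1 := h.polar_mul_add_polar_mul (x * y) y z 1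
  have h2 := h.polar_mul_right x z y
  rw [mem_skewPart_iff.mp hy] at h1
  simp only [mul_one] at h1
  simp only [polar_neg_left, polar_smul_left, smul_eq_mul]
  linear_combination h1 - h2

theorem self_mul_mul [Nontrivial B] (h : IsHurwitz F n) (x : B) {y : B}
    (hy : y ∈ skewPart F n) : y * (y * x) = -(n y • x) := by
  refine h.eq_of_polar fun z => ?_
  have h1 := h.polar_mul_add_polar_mul y (y * x) 1 z
  have h2 := h.polar_mul_left x z y
  rw [mem_skewPart_iff.mp hy] at h1
  simp only [one_mul] at h1
  simp only [polar_neg_left, polar_smul_left, smul_eq_mul]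
  linear_combination h1 - h2 - polar_comm n (y * z) (y * x)

theorem mul_swap [Nontrivial B] (h : IsHurwitz F n) {x y : B} (hx : x ∈ skewPart F n)
    (hy : y ∈ skewPart F n) : y * x = -(x * y) - polar n x y • (1 : B) := by
  have h1 := h.mul_self (x + y)
  have h2 := h.mul_self x
  have h3 := h.mul_self y
  rw [mem_skewPart_iff.mp (add_mem hx hy)] at h1
  rw [mem_skewPart_iff.mp hx] at h2
  rw [mem_skewPart_iff.mp hy] at h3
  simp only [mul_add, add_mul, h2, h3] at h1
  have h4 : polar n x y = n (x + y) - n x - n y := rfl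
  rw [h4]
  linear_combination (norm := module) h1

theorem commutator_commutator [Nontrivial B] [SMulCommClass F B B] [IsScalarTower F B B]
    (h : IsHurwitz F n) {x y : B} (hx : x ∈ skewPart F n) (hy : y ∈ skewPart F n) :
    (x * y - y * x) * y - y * (x * y - y * x) =
      (2 * polar n x y) • y - (2 * polar n y y) • x := by
  have h1 : (y * x) * y = n y • x - polar n x y • y := by
    rw [h.mul_swap hx hy, sub_mul, neg_mul, h.mul_mul_self x hy, neg_neg, smul_mul_assoc, one_mul]
  have h2 : y * (x * y) = n y • x - polar n x y • y := by
    rw [h.mul_swap hy hx, mul_sub, mul_neg, h.self_mul_mul x hy, neg_neg, mul_smul_comm, mul_one,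
      polar_comm]
  rw [sub_mul, mul_sub, h1, h2, h.mul_mul_self x hy, h.self_mul_mul x hy, polar_self, nsmul_eq_mul, Nat.cast_ofNat]
  module

theorem exists_anisotropic_orthogonal [Nontrivial B] (h : IsHurwitz F n) (hF : (2 : F) ≠ 0)
    (hdim : 3 < Module.finrank F B) (x : B) :
    ∃ y ∈ skewPart F n, polar n x y = 0 ∧ n y ≠ 0 := by
  by_contra! hn
  obtain ⟨z, hz, hz'⟩ : ∃ z ∈ skewPart F n, ∀ y ∈ skewPart F n,
      ∃ c : F, polar n x (y - c • z) = 0 := by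
    by_cases hx : ∃ z ∈ skewPart F n, polar n x z ≠ 0
    · obtain ⟨z, hz, hxz⟩ := hx
      refine ⟨z, hz, fun y _ => ⟨polar n x y / polar n x z, ?_⟩⟩
      rw [polar_sub_right, polar_smul_right, smul_eq_mul]
      field_simp
      ring
    · push Not at hx
      exact ⟨0, zero_mem _, fun y hy => ⟨0, by simpa using hx y hy⟩⟩
  have := h.1
  let L : B →ₗ[F] Fin 3 → F :=
    LinearMap.pi ![n.polarBilin 1, n.polarBilin x, n.polarBilin z]
  obtain ⟨w, hw, hw0⟩ := (Submodule.ne_bot_iff _).mp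
    (LinearMap.ker_ne_bot_of_finrank_lt (f := L) (by simpa using hdim))
  have hL (i : Fin 3) : L w i = 0 := congrFun (LinearMap.mem_ker.mp hw) i
  have h1 : polar n w 1 = 0 := by rw [polar_comm]; exact hL 0
  have hx : polar n x w = 0 := hL 1
  have hwz : polar n w z = 0 := by rw [polar_comm]; exact hL 2
  have hws : w ∈ skewPart F n := mem_skewPart_iff.mpr h1
  refine hw0 (h.2.1 w fun y => ?_)
  have hy := h.sub_half_mem_skewPart hF y
  obtain ⟨c, hc⟩ := hz' _ hy
  set v := y - (2⁻¹ * polar n y 1) • (1 : B) - c • z with hv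
  have hvs : v ∈ skewPart F n := sub_mem hy (Submodule.smul_mem _ _ hz)
  have hwv : polar n w v = 0 := by
    simp only [polar]
    rw [hn (w + v) (add_mem hws hvs) (by rw [polar_add_right, hx, hc, add_zero]),
      hn w hws hx, hn v hvs hc]
    ring
  rw [hv, polar_sub_right, polar_sub_right, polar_smul_right, polar_smul_right, h1, hwz] at hwv
  simpa using hwv

theorem exists_eq_commutator [Nontrivial B] [SMulCommClass F B B] [IsScalarTower F B B]
    (h : IsHurwitz F n) (hF : (2 : F) ≠ 0) (hdim : 3 < Module.finrank F B) {x : B}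
    (hx : x ∈ skewPart F n) :
    ∃ u ∈ skewPart F n, ∃ v ∈ skewPart F n, x = u * v - v * u := by
  obtain ⟨y, hy, hxy, hny⟩ := h.exists_anisotropic_orthogonal hF hdim x
  have hk : -(2 * polar n y y)⁻¹ • x ∈ skewPart F n := Submodule.smul_mem _ _ hx
  refine ⟨_, h.commutator_mem_skewPart (-(2 * polar n y y)⁻¹ • x) y, y, hy, ?_⟩
  have h2 : 2 * polar n y y ≠ 0 := by
    rw [polar_self, nsmul_eq_mul, Nat.cast_ofNat]
    exact mul_ne_zero hF (mul_ne_zero hF hny)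
  rw [h.commutator_commutator hk hy, polar_smul_left, hxy, smul_smul, mul_neg, mul_inv_cancel₀ h2]
  simp

end IsHurwitz

section Bracket

variable {A S : Type*} [CommRing A] [AddCommGroup S] [Module A S]
  (br : S →ₗ[A] S →ₗ[A] S) (B : S →ₗ[A] S →ₗ[A] A)

/-- The centroid of a perfect algebra whose bracket satisfies
`[[x, y], y] = 2 B(x, y) y - 2 B(y, y) x` consists of scalars. -/
theorem exists_smul_of_mem_centroid (h2 : IsUnit (2 : A))
    (hbr : ∀ x y, br (br x y) y = (2 * B x y) • y - (2 * B y y) • x)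
    (hperf : ∀ x, ∃ u v, x = br u v)
    (hu : ∃ u, IsUnit (B u u)) (T : S →+ S) (hT : ∀ x y, T (br x y) = br (T x) y) :
    ∃ c : A, ∀ x, T x = c • x := by
  have hT' (a : A) (x : S) : T (a • x) = a • T x := by
    obtain ⟨u, v, rfl⟩ := hperf x
    rw [← map_smul, hT, hT, map_smul]
  have key (x y : S) : B (T x) y • y = B x y • T y := by
    have h1 : T (br (br x y) y) = br (br (T x) y) y := by rw [hT, hT]
    rw [hbr, hbr, map_sub, hT', hT', sub_left_inj, mul_smul, mul_smul, h2.smul_left_cancel] at h1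
    exact h1.symm
  obtain ⟨u, hu⟩ := hu
  obtain ⟨r, hr⟩ := hu.exists_left_inv
  have hTu : T u = (r * B (T u) u) • u := by
    rw [mul_smul, key, smul_smul, hr, one_smul]
  set c := r * B (T u) u
  refine ⟨c, fun y => ?_⟩
  have h1 (y : S) : B u y • (T y - c • y) = 0 := by
    have := key u y
    rw [hTu, map_smul, LinearMap.smul_apply, smul_eq_mul] at this
    rw [smul_sub, ← this]
    module
  have h3 := h1 (y + u)
  have h4 : T (y + u) - c • (y + u) = T y - c • y := by
    rw [map_add, smul_add, ← hTu]; abel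
  rw [h4, map_add, add_smul, h1, zero_add, hu.smul_eq_zero] at h3
  exact sub_eq_zero.mp h3

/-- A bracket automorphism is semilinear over the centroid and preserves `B` up to
the induced endomorphism of the scalars. -/
theorem exists_ringHom_of_bracket_automorphism [IsReduced A] (h2 : IsUnit (2 : A))
    (hB : ∀ x y, B x y = B y x)
    (hbr : ∀ x y, br (br x y) y = (2 * B x y) • y - (2 * B y y) • x)
    (hperf : ∀ x, ∃ u v, x = br u v)
    (huv : ∃ u v, IsUnit (B u u) ∧ IsUnit (B v v) ∧ B u v = 0) (f : S ≃+ S)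
    (hf : ∀ x y, f (br x y) = br (f x) (f y)) :
    ∃ φ : A →+* A, Function.Injective φ ∧ (∀ a x, f (a • x) = φ a • f x) ∧
      ∀ x y, φ (B x y) = B (f x) (f y) := by
  obtain ⟨u, v, hu, hv, huv⟩ := huv
  have hf' (x y : S) : f.symm (br x y) = br (f.symm x) (f.symm y) := by
    apply f.injective; simp [hf]
  have hcen (a : A) : ∃ c : A, ∀ x, f (a • x) = c • f x := by
    obtain ⟨c, hc⟩ := exists_smul_of_mem_centroid br B h2 hbr hperf ⟨u, hu⟩
      (f.toAddMonoidHom.comp ((DistribSMul.toAddMonoidHom S a).comp f.symm.toAddMonoidHom))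
      (fun x y => by
        change f (a • f.symm (br x y)) = br (f (a • f.symm x)) y
        rw [hf', ← LinearMap.smul_apply, ← map_smul, hf, f.apply_symm_apply])
    exact ⟨c, fun x => by simpa using hc (f x)⟩
  choose φ hφ using hcen
  have hinj {a b : A} (hab : ∀ x : S, a • x = b • x) : a = b := by
    have := congrArg (B u) (hab u)
    rw [map_smul, map_smul, smul_eq_mul, smul_eq_mul] at this
    exact hu.mul_right_cancel this
  have hinj' {a b : A} (hab : ∀ x : S, a • f x = b • f x) : a = b :=
    hinj fun x => by simpa using hab (f.symm x)
  let φ' : A →+* A :=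
    { toFun := φ
      map_one' := hinj' fun x => by rw [← hφ, one_smul, one_smul]
      map_mul' := fun a b => hinj' fun x => by rw [← hφ, mul_smul, mul_smul, hφ, hφ]
      map_zero' := hinj' fun x => by rw [← hφ, zero_smul, zero_smul, map_zero]
      map_add' := fun a b => hinj' fun x => by rw [← hφ, add_smul, add_smul, map_add, hφ, hφ] }
  have hφ' (a : A) (x : S) : f (a • x) = φ' a • f x := hφ a x
  clear_value φ'
  have hself (y : S) : φ' (B y y) = B (f y) (f y) := by
    set D := φ' (B y y) - B (f y) (f y) with hD
    have hE (z : S) : ∃ E : A, D • z = E • f y := by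
      obtain ⟨x, rfl⟩ := f.surjective z
      refine ⟨φ' (B x y) - B (f x) (f y), ?_⟩
      have h := hf (br x y) y
      rw [hf x y, hbr, hbr, map_sub, hφ', hφ', map_mul, map_mul, map_ofNat, mul_smul, mul_smul,
        mul_smul, mul_smul, ← smul_sub, ← smul_sub, h2.smul_left_cancel] at h
      rw [hD, sub_smul, sub_smul]
      linear_combination (norm := module) -h
    obtain ⟨E, hEu⟩ := hE u
    obtain ⟨E', hEv⟩ := hE v
    have e1 := congrArg (B u) hEu
    have e2 := congrArg (B v) hEu
    have e3 := congrArg (B v) hEv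
    simp only [map_smul, smul_eq_mul, hB v u, huv, mul_zero] at e1 e2 e3
    have h0 : (D * D) * (B u u * B v v) = 0 := by
      linear_combination (D * B v v) * e1 + E * B u (f y) * e3 - E' * B u (f y) * e2
    rw [(hu.mul hv).mul_left_eq_zero] at h0
    exact sub_eq_zero.mp (IsNilpotent.eq_zero ⟨2, by rw [sq, h0]⟩)
  refine ⟨φ', (injective_iff_map_eq_zero φ').mpr fun a ha => hinj fun x => ?_, hφ', fun x y => ?_⟩
  · apply f.injective
    rw [hφ', ha, zero_smul, zero_smul, map_zero]
  · have h := hself (x + y)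
    simp only [map_add, LinearMap.add_apply, hself, hB y x, hB (f y) (f x)] at h
    apply h2.mul_left_cancel
    linear_combination h

end Bracket

/-- An automorphism of the trace-zero part of a quadratic algebra over `A`, semilinear along `φ`
and compatible with bracket and form, extends to a multiplicative map. -/
theorem exists_extension_of_bracket_automorphism {A P : Type*} [CommRing A] [NonAssocRing P]
    [Module A P] [SMulCommClass A P P] [IsScalarTower A P P] (S : Submodule A P)
    (τ : P →ₗ[A] A) (hτ : τ 1 = 1) (hS : ∀ x, x ∈ S ↔ τ x = 0) (br : S →ₗ[A] S →ₗ[A] S)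
    (B : S →ₗ[A] S →ₗ[A] A) (h : A)
    (hmul : ∀ x y : S, (x : P) * y = h • (br x y : P) - (h * B x y) • 1)
    (φ : A →+* A) (hφ : Function.Injective φ) (hφh : φ h = h) (f : S ≃+ S)
    (hf : ∀ x y, f (br x y) = br (f x) (f y)) (hφf : ∀ a x, f (a • x) = φ a • f x)
    (hφB : ∀ x y, φ (B x y) = B (f x) (f y)) :
    ∃ e : P →+ P, Function.Injective e ∧ (∀ x y, e (x * y) = e x * e y) ∧
      (∀ a x, e (a • x) = φ a • e x) ∧ ∀ x : S, e x = f x := by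
  have hproj (p : P) : p - τ p • (1 : P) ∈ S := by simp [hS, hτ]
  have hdec (p : P) : ∃ (a : A) (x : S), p = a • (1 : P) + x := ⟨τ p, ⟨_, hproj p⟩, by simp⟩
  let e : P →+ P := AddMonoidHom.mk' (fun p => φ (τ p) • (1 : P) + f ⟨_, hproj p⟩) fun p q => by
    have : (⟨_, hproj (p + q)⟩ : S) = ⟨_, hproj p⟩ + ⟨_, hproj q⟩ := by
      ext
      simp only [map_add, Submodule.coe_add]
      module
    rw [this, map_add, map_add, map_add, Submodule.coe_add]
    module
  have he (a : A) (x : S) : e (a • (1 : P) + x) = φ a • (1 : P) + f x := by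
    have h1 : τ (a • (1 : P) + x) = a := by simp [hτ, (hS x).mp x.2]
    have h2 : (⟨_, hproj (a • (1 : P) + x)⟩ : S) = x := by
      ext
      simp [h1]
    change φ (τ _) • (1 : P) + (f ⟨_, hproj (a • (1 : P) + x)⟩ : P) = _
    rw [h2, h1]
  have hm (a b : A) (x y : S) : (a • (1 : P) + x) * (b • (1 : P) + y) =
      (a * b - h * B x y) • (1 : P) + (a • y + b • x + h • br x y : S) := by
    simp only [mul_add, add_mul, smul_mul_assoc, mul_smul_comm, one_mul, mul_one, hmul,
      Submodule.coe_add, Submodule.coe_smul]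
    module
  refine ⟨e, (injective_iff_map_eq_zero e).mpr fun p hp => ?_, fun p q => ?_, fun c p => ?_,
    fun x => ?_⟩
  · obtain ⟨a, x, rfl⟩ := hdec p
    rw [he] at hp
    have ha := congrArg τ hp
    rw [map_add, map_smul, hτ, (hS _).mp (f x).2] at ha
    have ha : φ a = 0 := by simpa using ha
    rw [ha, zero_smul, zero_add] at hp
    have hx : f x = 0 := Subtype.ext hp
    rw [map_eq_zero_iff φ hφ] at ha
    rw [map_eq_zero_iff f f.injective] at hx
    simp [ha, hx]
  · obtain ⟨a, x, rfl⟩ := hdec p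
    obtain ⟨b, y, rfl⟩ := hdec q
    simp only [hm, he, map_add, map_sub, map_mul, hφf, hf, hφh, hφB]
  · obtain ⟨a, x, rfl⟩ := hdec p
    rw [smul_add, smul_smul, ← Submodule.coe_smul, he, he, map_mul, hφf]
    simp only [Submodule.coe_smul]
    module
  · simpa using he 0 x

section Product

open QuadraticMap

variable {F : Type*} [Field F] {m : ℕ} {C : Fin m → Type*} [∀ i, NonAssocRing (C i)]
  [∀ i, Module F (C i)]

theorem mem_skewPi {n : ∀ i, QuadraticForm F (C i)} {x : Π i, C i} :
    x ∈ skewPi F n ↔ ∀ i, x i ∈ skewPart F (n i) := by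
  simp [skewPi]

theorem commutator_mem_skewPi [∀ i, Nontrivial (C i)] {n : ∀ i, QuadraticForm F (C i)}
    (hn : ∀ i, IsHurwitz F (n i)) (x y : Π i, C i) : x * y - y * x ∈ skewPi F n :=
  mem_skewPi.mpr fun i => (hn i).commutator_mem_skewPart (x i) (y i)

theorem exists_eq_commutator_of_mem_skewPi [∀ i, Nontrivial (C i)]
    [∀ i, SMulCommClass F (C i) (C i)] [∀ i, IsScalarTower F (C i) (C i)]
    {n : ∀ i, QuadraticForm F (C i)} (hn : ∀ i, IsHurwitz F (n i)) (hF : (2 : F) ≠ 0)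
    (hdim : ∀ i, 3 < Module.finrank F (C i)) {x : Π i, C i} (hx : x ∈ skewPi F n) :
    ∃ u ∈ skewPi F n, ∃ v ∈ skewPi F n, x = u * v - v * u := by
  choose u hu v hv h using fun i => (hn i).exists_eq_commutator hF (hdim i) (mem_skewPi.mp hx i)
  exact ⟨u, mem_skewPi.mpr hu, v, mem_skewPi.mpr hv, funext h⟩

theorem exists_eq_mul_add_of_skewPi [∀ i, Nontrivial (C i)]
    [∀ i, IsScalarTower F (C i) (C i)]
    {n : ∀ i, QuadraticForm F (C i)} (hn : ∀ i, IsHurwitz F (n i)) (hF : (2 : F) ≠ 0)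
    (hdim : ∀ i, 3 < Module.finrank F (C i)) (x : Π i, C i) :
    ∃ u ∈ skewPi F n, ∃ v ∈ skewPi F n, ∃ w ∈ skewPi F n, x = u * v + w := by
  have (i : Fin m) : ∃ u ∈ skewPart F (n i), ∃ v ∈ skewPart F (n i), ∃ w ∈ skewPart F (n i),
      x i = u * v + w := by
    obtain ⟨y, hy, -, hny⟩ := (hn i).exists_anisotropic_orthogonal hF (hdim i) 0
    refine ⟨-((2⁻¹ * polar (n i) (x i) 1) * (n i y)⁻¹) • y, Submodule.smul_mem _ _ hy, y, hy, _,
      (hn i).sub_half_mem_skewPart hF (x i), ?_⟩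
    rw [smul_mul_assoc, (hn i).mul_self, IsHurwitz.mem_skewPart_iff.mp hy, zero_smul, zero_sub,
      smul_neg, neg_smul, neg_neg, smul_smul, mul_assoc, inv_mul_cancel₀ hny, mul_one]
    abel
  choose u hu v hv w hw h using this
  exact ⟨u, mem_skewPi.mpr hu, v, mem_skewPi.mpr hv, w, mem_skewPi.mpr hw, funext h⟩

/-- The product of skew parts as a submodule over `F × ⋯ × F`. -/
def skewPiSubmodule (n : ∀ i, QuadraticForm F (C i)) : Submodule (Fin m → F) (Π i, C i) where
  carrier := {x | ∀ i, x i ∈ skewPart F (n i)}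
  add_mem' hx hy i := add_mem (hx i) (hy i)
  zero_mem' _ := zero_mem _
  smul_mem' a _ hx i := Submodule.smul_mem _ (a i) (hx i)

theorem mem_skewPiSubmodule {n : ∀ i, QuadraticForm F (C i)} {x : Π i, C i} :
    x ∈ skewPiSubmodule n ↔ ∀ i, x i ∈ skewPart F (n i) :=
  Iff.rfl

theorem mem_skewPiSubmodule_iff_mem_skewPi {n : ∀ i, QuadraticForm F (C i)} {x : Π i, C i} :
    x ∈ skewPiSubmodule n ↔ x ∈ skewPi F n := by
  rw [mem_skewPiSubmodule, mem_skewPi]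

/-- The identity map between the two module structures on the product of skew parts. -/
def skewPiSubmoduleEquiv (n : ∀ i, QuadraticForm F (C i)) : skewPiSubmodule n ≃+ skewPi F n where
  toFun x := ⟨x, mem_skewPiSubmodule_iff_mem_skewPi.mp x.2⟩
  invFun x := ⟨x, mem_skewPiSubmodule_iff_mem_skewPi.mpr x.2⟩
  map_add' _ _ := rfl

instance [∀ i, IsScalarTower F (C i) (C i)] :
    IsScalarTower (Fin m → F) (Π i, C i) (Π i, C i) :=
  ⟨fun a x y => funext fun i => smul_mul_assoc (a i) (x i) (y i)⟩

instance [∀ i, SMulCommClass F (C i) (C i)] :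
    SMulCommClass (Fin m → F) (Π i, C i) (Π i, C i) :=
  ⟨fun a x y => funext fun i => (mul_smul_comm (a i) (x i) (y i)).symm⟩

/-- The commutator product on the product of skew parts, bilinear over `F × ⋯ × F`. -/
def skewPiBracket [∀ i, Nontrivial (C i)] [∀ i, SMulCommClass F (C i) (C i)]
    [∀ i, IsScalarTower F (C i) (C i)] {n : ∀ i, QuadraticForm F (C i)}
    (hn : ∀ i, IsHurwitz F (n i)) : skewPiSubmodule n →ₗ[Fin m → F]
      skewPiSubmodule n →ₗ[Fin m → F] skewPiSubmodule n :=
  LinearMap.mk₂ _ (fun x y => ⟨(x : Π i, C i) * y - y * x,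
      mem_skewPiSubmodule_iff_mem_skewPi.mpr (commutator_mem_skewPi hn _ _)⟩)
    (fun x y z => by ext1; simp only [Submodule.coe_add, add_mul, mul_add]; abel)
    (fun a x y => by
      ext1; simp only [Submodule.coe_smul, smul_mul_assoc, mul_smul_comm, smul_sub])
    (fun x y z => by ext1; simp only [Submodule.coe_add, add_mul, mul_add]; abel)
    (fun a x y => by
      ext1; simp only [Submodule.coe_smul, smul_mul_assoc, mul_smul_comm, smul_sub])

theorem coe_skewPiBracket [∀ i, Nontrivial (C i)] [∀ i, SMulCommClass F (C i) (C i)]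
    [∀ i, IsScalarTower F (C i) (C i)] {n : ∀ i, QuadraticForm F (C i)}
    (hn : ∀ i, IsHurwitz F (n i)) (x y : skewPiSubmodule n) :
    (skewPiBracket hn x y : Π i, C i) = x * y - y * x := rfl

/-- The componentwise polar form, bilinear over `F × ⋯ × F`. -/
def polarPi (n : ∀ i, QuadraticForm F (C i)) :
    (Π i, C i) →ₗ[Fin m → F] (Π i, C i) →ₗ[Fin m → F] Fin m → F :=
  LinearMap.mk₂ _ (fun x y i => polar (n i) (x i) (y i))
    (fun _ _ _ => funext fun _ => polar_add_left _ _ _ _)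
    (fun _ _ _ => funext fun _ => polar_smul_left _ _ _ _)
    (fun _ _ _ => funext fun _ => polar_add_right _ _ _ _)
    (fun _ _ _ => funext fun _ => polar_smul_right _ _ _ _)

theorem exists_extension_of_skewPi_automorphism [∀ i, Nontrivial (C i)]
    [∀ i, SMulCommClass F (C i) (C i)] [∀ i, IsScalarTower F (C i) (C i)]
    {n : ∀ i, QuadraticForm F (C i)} (hn : ∀ i, IsHurwitz F (n i)) (hF : (2 : F) ≠ 0)
    (hdim : ∀ i, 3 < Module.finrank F (C i)) (f : skewPi F n →ₗ[F] skewPi F n)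
    (hbij : Function.Bijective f)
    (hf : ∀ x y : skewPi F n, (f ⟨_, commutator_mem_skewPi hn x y⟩ : Π i, C i) =
      (f x : Π i, C i) * f y - f y * f x) :
    ∃ e : (Π i, C i) ≃ₗ[F] (Π i, C i), (∀ x y, e (x * y) = e x * e y) ∧
      ∀ x : skewPi F n, e x = f x := by
  have (i : Fin m) := (hn i).1
  have hSi (x : skewPiSubmodule n) (i : Fin m) : x.1 i ∈ skewPart F (n i) :=
    mem_skewPiSubmodule.mp x.2 i
  have hbr := coe_skewPiBracket hn
  obtain ⟨B, hB⟩ : ∃ B : skewPiSubmodule n →ₗ[Fin m → F] skewPiSubmodule n →ₗ[Fin m → F]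
      Fin m → F, ∀ x y i, B x y i = polar (n i) (x.1 i) (y.1 i) :=
    ⟨(polarPi n).domRestrict₁₂ _ _, fun _ _ _ => rfl⟩
  obtain ⟨g, hg⟩ : ∃ g : skewPiSubmodule n ≃+ skewPiSubmodule n,
      ∀ x, (g x : Π i, C i) = f (skewPiSubmoduleEquiv n x) :=
    ⟨((skewPiSubmoduleEquiv n).trans (LinearEquiv.ofBijective f hbij).toAddEquiv).trans
      (skewPiSubmoduleEquiv n).symm, fun _ => rfl⟩
  have hgbr (x y : skewPiSubmodule n) :
      g (skewPiBracket hn x y) = skewPiBracket hn (g x) (g y) := by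
    ext1
    rw [hbr, hg, hg, hg]
    exact hf (skewPiSubmoduleEquiv n x) (skewPiSubmoduleEquiv n y)
  generalize skewPiBracket hn = br at hbr hgbr
  let h : Fin m → F := fun _ => 2⁻¹
  have h2h : 2 * h = 1 := funext fun _ => mul_inv_cancel₀ hF
  have h2 : IsUnit (2 : Fin m → F) := IsUnit.of_mul_eq_one h h2h
  have hunit {a : Fin m → F} (ha : ∀ i, a i ≠ 0) : IsUnit a :=
    Pi.isUnit_iff.mpr fun i => (ha i).isUnit
  have hpol {i : Fin m} {x : C i} (hx : n i x ≠ 0) : polar (n i) x x ≠ 0 := by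
    rw [polar_self, nsmul_eq_mul, Nat.cast_ofNat]
    exact mul_ne_zero hF hx
  have huv : ∃ u v, IsUnit (B u u) ∧ IsUnit (B v v) ∧ B u v = 0 := by
    choose u hu _ hnu using fun i => (hn i).exists_anisotropic_orthogonal hF (hdim i) 0
    choose v hv huv hnv using fun i => (hn i).exists_anisotropic_orthogonal hF (hdim i) (u i)
    refine ⟨⟨u, mem_skewPiSubmodule.mpr hu⟩, ⟨v, mem_skewPiSubmodule.mpr hv⟩, hunit fun i => ?_, hunit fun i => ?_,
      funext fun i => ?_⟩
    · rw [hB]; exact hpol (hnu i)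
    · rw [hB]; exact hpol (hnv i)
    · rw [hB]; exact huv i
  obtain ⟨φ, hφ, hφg, hφB⟩ := exists_ringHom_of_bracket_automorphism br B h2
    (fun x y => funext fun i => by rw [hB, hB, polar_comm])
    (fun x y => Subtype.ext <| funext fun i => by
      simpa [hbr, hB] using (hn i).commutator_commutator (hSi x i) (hSi y i))
    (fun x => by
      obtain ⟨u, hu, v, hv, hx⟩ := exists_eq_commutator_of_mem_skewPi hn hF hdim
        (mem_skewPiSubmodule_iff_mem_skewPi.mp x.2)
      exact ⟨⟨u, mem_skewPiSubmodule_iff_mem_skewPi.mpr hu⟩,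
        ⟨v, mem_skewPiSubmodule_iff_mem_skewPi.mpr hv⟩, Subtype.ext (by rw [hbr]; exact hx)⟩)
    huv g hgbr
  obtain ⟨u, -, hu, -, -⟩ := huv
  have hφF (c : F) : φ (fun _ => c) = fun _ => c := by
    have h1 : g ((fun _ : Fin m => c) • u) = (fun _ : Fin m => c) • g u :=
      Subtype.ext (by
        rw [Submodule.coe_smul, hg, hg]
        exact congrArg Subtype.val (f.map_smul c (skewPiSubmoduleEquiv n u)))
    have h3 := congrArg (B (g u)) ((hφg _ u).symm.trans h1)
    rw [map_smul, map_smul, ← hφB] at h3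
    exact (hu.map φ).mul_right_cancel h3
  have hτ1 : (h • (polarPi n).flip 1) 1 = 1 := funext fun i => by
    change 2⁻¹ * polar (n i) 1 1 = 1
    rw [(hn i).polar_one_one, inv_mul_cancel₀ hF]
  obtain ⟨e, he, hemul, hesmul, heg⟩ := exists_extension_of_bracket_automorphism
    (skewPiSubmodule n) (h • (polarPi n).flip 1) hτ1
    (fun x => by
      rw [mem_skewPiSubmodule, funext_iff]
      refine forall_congr' fun i => ?_
      rw [IsHurwitz.mem_skewPart_iff]
      change _ ↔ 2⁻¹ * polar (n i) (x i) 1 = 0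
      simp [hF])
    br B h
    (fun x y => by
      ext i
      simp only [hbr, Pi.mul_apply, Pi.sub_apply, Pi.smul_apply', hB, Pi.one_apply]
      change _ = (2⁻¹ : F) • _ - ((2⁻¹ : F) * _) • _
      rw [(hn i).mul_swap (hSi x i) (hSi y i)]
      match_scalars <;> field_simp <;> ring)
    φ hφ (hφF _) g hgbr hφg hφB
  let e' : (Π i, C i) →ₗ[F] (Π i, C i) :=
    { e with
      map_smul' := fun c x => by
        have := hesmul (fun _ => c) x
        rwa [hφF] at this }
  exact ⟨LinearEquiv.ofInjectiveEndo e' he, hemul, fun x =>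
    (heg ((skewPiSubmoduleEquiv n).symm x)).trans (hg _)⟩

end Product

/-- Over an algebraically closed field `F` of characteristic `≠ 2`, let
`C¹, …, Cⁿ` be Cayley algebras.  Every algebra automorphism of `C¹ × ⋯ × Cⁿ` maps
`S = C¹₀ × ⋯ × Cⁿ₀` onto itself, and the restriction map is a bijective group homomorphism
from `Aut(C¹ × ⋯ × Cⁿ)` onto the automorphism group of `(S, [·,·])` with the componentwise
commutator product: the restriction map is injective, surjective onto the bracket
automorphisms of `S`, and preserves composition. -/
theorem restriction_to_skew_of_product_of_cayley (F : Type*) [Field F] [IsAlgClosed F]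
    (hF : (2 : F) ≠ 0) {m : ℕ} (C : Fin m → Type*) [∀ i, NonAssocRing (C i)]
    [∀ i, Module F (C i)] [∀ i, SMulCommClass F (C i) (C i)] [∀ i, IsScalarTower F (C i) (C i)]
    (n : ∀ i, QuadraticForm F (C i)) (hHur : ∀ i, IsHurwitz F (n i))
    (hdim : ∀ i, Module.finrank F (C i) = 8) :
    -- every automorphism maps `S` onto itself:
    (∀ e : (Π i, C i) ≃ₗ[F] (Π i, C i), (∀ x y, e (x * y) = e x * e y) →
        (skewPi F n).map e.toLinearMap = skewPi F n) ∧
    -- the restriction map preserves composition (it is a group homomorphism):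
    (∀ e₁ e₂ : (Π i, C i) ≃ₗ[F] (Π i, C i), (∀ x y, e₁ (x * y) = e₁ x * e₁ y) →
      (∀ x y, e₂ (x * y) = e₂ x * e₂ y) →
      ∀ x ∈ skewPi F n, (e₁ ≪≫ₗ e₂) x = e₂ (e₁ x)) ∧
    -- the restriction map is injective:
    (∀ e₁ e₂ : (Π i, C i) ≃ₗ[F] (Π i, C i), (∀ x y, e₁ (x * y) = e₁ x * e₁ y) →
      (∀ x y, e₂ (x * y) = e₂ x * e₂ y) →
      (∀ x ∈ skewPi F n, e₁ x = e₂ x) → e₁ = e₂) ∧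
    -- the restriction map is surjective onto the automorphisms of `(S, [·,·])`:
    (∀ f : skewPi F n →ₗ[F] skewPi F n, Function.Bijective f →
      (∀ (x y : skewPi F n)
        (hxy : (x : Π i, C i) * (y : Π i, C i) - (y : Π i, C i) * (x : Π i, C i) ∈ skewPi F n),
        (f ⟨(x : Π i, C i) * (y : Π i, C i) - (y : Π i, C i) * (x : Π i, C i), hxy⟩ : Π i, C i) =
          (f x : Π i, C i) * (f y : Π i, C i) - (f y : Π i, C i) * (f x : Π i, C i)) →
      ∃ e : (Π i, C i) ≃ₗ[F] (Π i, C i), (∀ x y, e (x * y) = e x * e y) ∧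
        ∀ x : skewPi F n, e x = f x) := by
  have (i : Fin m) : Nontrivial (C i) := Module.nontrivial_of_finrank_pos (R := F) (by simp [hdim])
  have hdim (i : Fin m) : 3 < Module.finrank F (C i) := by simp [hdim]
  have hmem (e : (Π i, C i) ≃ₗ[F] (Π i, C i)) (he : ∀ x y, e (x * y) = e x * e y) (x : Π i, C i)
      (hx : x ∈ skewPi F n) : e x ∈ skewPi F n := by
    obtain ⟨u, -, v, -, rfl⟩ := exists_eq_commutator_of_mem_skewPi hHur hF hdim hx
    rw [map_sub, he, he]
    exact commutator_mem_skewPi hHur _ _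
  refine ⟨fun e he => le_antisymm ?_ fun x hx => ?_, fun _ _ _ _ _ _ => rfl,
    fun e₁ e₂ he₁ he₂ h => LinearEquiv.ext fun x => ?_, fun f hbij hf => ?_⟩
  · rintro _ ⟨x, hx, rfl⟩
    exact hmem e he x hx
  · refine ⟨e.symm x, hmem e.symm (fun a b => e.injective ?_) x hx, e.apply_symm_apply x⟩
    simp [he]
  · obtain ⟨u, hu, v, hv, w, hw, rfl⟩ := exists_eq_mul_add_of_skewPi hHur hF hdim x
    rw [map_add, map_add, he₁, he₂, h u hu, h v hv, h w hw]
  · exact exists_extension_of_skewPi_automorphism hHur hF hdim f hbij fun x y => hf x y _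
end
end

section
/- Let F be a field, G an abelian group, and A a finite-dimensional F-algebra equipped with a G-grading A = ⊕_{g∈G} A_g. Suppose A = A₁ ⊕ A₂ where A₁ and A₂ are two-sided ideals of A, each of which is a central simple algebra, and suppose dim_F A₁ ≠ dim_F A₂. Then A₁ and A₂ are graded subspaces of A. -/
noncomputable section

/-- A `G`-grading on a (not necessarily associative or unital) `F`-algebra `A`:
a direct-sum decomposition `A = ⊕_{g ∈ G} A_g` (independent components whose sum is
everything) with `A_g · A_h ⊆ A_{g+h}`. -/
def IsGrading (F : Type*) [Field F] {G : Type*} [AddCommGroup G] {A : Type*}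
    [NonUnitalNonAssocRing A] [Module F A] (𝒜 : G → Submodule F A) : Prop :=
  (∀ g : G, Disjoint (𝒜 g) (⨆ h : G, ⨆ _ : h ≠ g, 𝒜 h)) ∧
    (⨆ g : G, 𝒜 g) = ⊤ ∧
    ∀ ⦃g h : G⦄ ⦃x y : A⦄, x ∈ 𝒜 g → y ∈ 𝒜 h → x * y ∈ 𝒜 (g + h)

/-- A subspace `V` is graded when `V = ⊕_{g ∈ G} (V ∩ A_g)`. -/
def IsGradedSubspace (F : Type*) [Field F] {G : Type*} [AddCommGroup G] {A : Type*}
    [NonUnitalNonAssocRing A] [Module F A] (𝒜 : G → Submodule F A)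
    (V : Submodule F A) : Prop :=
  V = ⨆ g : G, V ⊓ 𝒜 g

section GradedLinearAlgebra

variable {F G A : Type*} [Field F]

section Module

variable [AddCommGroup A] [Module F A] {𝒜 : G → Submodule F A}

/-- Linear maps given on the components of a direct sum decomposition glue. -/
theorem exists_linearMap_eq_on_components (hind : iSupIndep 𝒜) (htop : (⨆ g, 𝒜 g) = ⊤)
    (f : G → A →ₗ[F] A) : ∃ L : A →ₗ[F] A, ∀ g, ∀ x ∈ 𝒜 g, L x = f g x := by
  classical
  let := (DirectSum.isInternal_submodule_of_iSupIndep_of_iSup_eq_top hind htop).chooseDecomposition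
  refine ⟨(DirectSum.toModule F G A fun g => f g ∘ₗ (𝒜 g).subtype) ∘ₗ
    (DirectSum.decomposeLinearEquiv 𝒜).toLinearMap, fun g x hx => ?_⟩
  lift x to 𝒜 g using hx
  simp [DirectSum.toModule_lof]

theorem mem_of_projections_eq_zero {π : G → A →ₗ[F] A} (htop : (⨆ g, 𝒜 g) = ⊤)
    (hsame : ∀ g, ∀ x ∈ 𝒜 g, π g x = x)
    (hne : ∀ g h, g ≠ h → ∀ x ∈ 𝒜 g, π h x = 0) {h : G} {x : A}
    (hx : ∀ g, g ≠ h → π g x = 0) : x ∈ 𝒜 h := by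
  classical
  obtain ⟨f, hf, rfl⟩ := (Submodule.mem_iSup_iff_exists_finsupp 𝒜 x).1 (by rw [htop]; trivial)
  refine Submodule.sum_mem _ fun g _ => ?_
  by_cases hg : g = h
  · subst hg; exact hf g
  · have := hx g hg
    rw [Finsupp.sum, map_sum, Finset.sum_eq_single g
      (fun k _ hk => hne k g hk _ (hf k)) (by simp +contextual), hsame g _ (hf g)] at this
    simp [this]

variable [AddCommGroup G]

theorem induction_of_iSup_eq_top (htop : (⨆ g, 𝒜 g) = ⊤) {p : A → Prop}
    (hmem : ∀ g, ∀ x ∈ 𝒜 g, p x) (hadd : ∀ x y, p x → p y → p (x + y)) (x : A) : p x := by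
  refine Submodule.iSup_induction 𝒜 (motive := p) (x := x) (by rw [htop]; trivial) hmem ?_ hadd
  exact hmem 0 0 (zero_mem _)

theorem exists_component_projections (hind : iSupIndep 𝒜) (htop : (⨆ g, 𝒜 g) = ⊤) :
    ∃ π : G → A →ₗ[F] A, (∀ g x, π g x ∈ 𝒜 g) ∧ (∀ g, ∀ x ∈ 𝒜 g, π g x = x) ∧
      ∀ g h, g ≠ h → ∀ x ∈ 𝒜 g, π h x = 0 := by
  classical
  choose π hπ using fun k : G => exists_linearMap_eq_on_components hind htop
    fun h => if h = k then LinearMap.id else 0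
  refine ⟨π, fun g => ?_, fun g x hx => by simp [hπ g g x hx],
    fun g h hgh x hx => by simp [hπ h g x hx, hgh]⟩
  refine induction_of_iSup_eq_top htop (fun h x hx => ?_) fun x y hx hy => ?_
  · rw [hπ g h x hx]
    split_ifs with hhg
    · subst hhg; exact hx
    · exact zero_mem _
  · rw [map_add]; exact add_mem hx hy

/-- The range of a degree-preserving idempotent is a graded subspace. -/
theorem eq_iSup_inf_of_map_mem {V : Submodule F A} (htop : (⨆ g, 𝒜 g) = ⊤) (p : A →ₗ[F] A)
    (hp : ∀ x, p x ∈ V) (hpV : ∀ x ∈ V, p x = x) (hdeg : ∀ g, ∀ x ∈ 𝒜 g, p x ∈ 𝒜 g) :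
    V = ⨆ g, V ⊓ 𝒜 g := by
  refine le_antisymm (fun x hx => ?_) (iSup_le fun _ => inf_le_left)
  rw [← hpV x hx]
  refine induction_of_iSup_eq_top (p := fun x => p x ∈ ⨆ g, V ⊓ 𝒜 g) htop
    (fun g x hx => Submodule.mem_iSup_of_mem g ⟨hp x, hdeg g x hx⟩) (fun x y hx hy => ?_) x
  rw [map_add]; exact add_mem hx hy

/-- A grading-shifting linear map by a nonzero element of order two anticommutes with some
linear involution. -/
theorem exists_involution_anticommute (hind : iSupIndep 𝒜) (htop : (⨆ g, 𝒜 g) = ⊤)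
    {g : G} (hg : g ≠ 0) (hgg : g + g = 0) (v : A →ₗ[F] A)
    (hv : ∀ h, ∀ x ∈ 𝒜 h, v x ∈ 𝒜 (g + h)) :
    ∃ φ : A →ₗ[F] A, (∀ x, φ (φ x) = x) ∧ ∀ x, v (φ x) = -φ (v x) := by
  classical
  let ε : G → F := fun h => if WellOrderingRel h (g + h) then 1 else -1
  have hε : ∀ h, ε h * ε h = 1 := fun h => by simp only [ε]; split_ifs <;> simp
  have hεg : ∀ h, ε (g + h) = -ε h := fun h => by
    have h1 : g + (g + h) = h := by rw [← add_assoc, hgg, zero_add]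
    simp only [ε, h1]
    rcases trichotomous_of WellOrderingRel h (g + h) with h2 | h2 | h2
    · simp [h2, asymm_of WellOrderingRel h2]
    · exact absurd (by simpa using h2) hg
    · simp [h2, asymm_of WellOrderingRel h2]
  obtain ⟨φ, hφ⟩ := exists_linearMap_eq_on_components hind htop
    fun h => ε h • (LinearMap.id : A →ₗ[F] A)
  refine ⟨φ, induction_of_iSup_eq_top htop (fun h x hx => ?_) fun x y hx hy => ?_,
    induction_of_iSup_eq_top htop (fun h x hx => ?_) fun x y hx hy => ?_⟩
  · simp [hφ h x hx, smul_smul, hε]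
  · simp [hx, hy]
  · simp [hφ h x hx, hφ (g + h) _ (hv h x hx), hεg]
  · simp only [map_add, hx, hy]; abel

/-- If a projection `p` differs from a scalar by a map shifting degrees by `g ≠ 0`, then either
`p` preserves degrees or its range and kernel have equal dimension. -/
theorem map_mem_or_finrank_eq_of_shift [FiniteDimensional F A] (hind : iSupIndep 𝒜)
    (htop : (⨆ g, 𝒜 g) = ⊤) {p : A →ₗ[F] A} (hpp : ∀ x, p (p x) = p x) {V W : Submodule F A}
    (hV : ∀ x, x ∈ V ↔ p x = x) (hW : ∀ x, x ∈ W ↔ p x = 0)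
    {g : G} (hg : g ≠ 0) {c : F} (hc : ∀ h, ∀ x ∈ 𝒜 h, p x - c • x ∈ 𝒜 (g + h)) :
    (∀ h, ∀ x ∈ 𝒜 h, p x ∈ 𝒜 h) ∨ Module.finrank F V = Module.finrank F W := by
  obtain ⟨π, hmem, hsame, hne⟩ := exists_component_projections hind htop
  let v : A →ₗ[F] A := p - c • LinearMap.id
  have hv : ∀ x, v x = p x - c • x := fun x => rfl
  have hvv : ∀ x, v (v x) = (1 - 2 * c) • v x + (c - c * c) • x := fun x => by
    simp only [hv, map_sub, map_smul, hpp]; module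
  have hdeg : ∀ h, ∀ x ∈ 𝒜 h, v x ∈ 𝒜 (g + h) := hc
  by_cases h2c : 2 * c = 1
  · right
    by_cases hgg : g + g = 0
    · obtain ⟨φ, hφ, hanti⟩ := exists_involution_anticommute hind htop hg hgg v hdeg
      have hinj : Function.Injective φ := Function.LeftInverse.injective hφ
      have key : ∀ x, p (φ x) = φ x - φ (p x) := fun x => by
        have := hanti x
        simp only [hv, map_sub, map_smul] at this
        have h3 : φ x = c • φ x + c • φ x := by rw [← add_smul, ← two_mul, h2c, one_smul]
        have h4 : p (φ x) = c • φ x + c • φ x - φ (p x) := by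
          rw [sub_eq_iff_eq_add] at this; rw [this]; abel
        rw [h4, ← h3]
      refine le_antisymm ?_ ?_
      · rw [← LinearMap.finrank_range_of_inj (f := φ.domRestrict V)
          (hinj.comp Subtype.val_injective)]
        refine Submodule.finrank_mono ?_
        rintro _ ⟨⟨x, hx⟩, rfl⟩
        simp [hW, key, (hV x).1 hx]
      · rw [← LinearMap.finrank_range_of_inj (f := φ.domRestrict W)
          (hinj.comp Subtype.val_injective)]
        refine Submodule.finrank_mono ?_
        rintro _ ⟨⟨x, hx⟩, rfl⟩
        simp [hV, key, (hW x).1 hx]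
    · have hzero : ∀ x : A, x = 0 := by
        refine induction_of_iSup_eq_top htop (fun h x hx => ?_) fun x y hx hy => ?_
        · have h1 := hvv x
          have h5 := hne (g + (g + h)) h (by rw [← add_assoc]; simpa using hgg) _
            (hdeg _ _ (hdeg _ _ hx))
          rw [h1, h2c, sub_self, zero_smul, zero_add, map_smul, hsame h x hx] at h5
          refine (smul_eq_zero.1 h5).resolve_left fun h6 => ?_
          have h7 : (2 * c) * (2 * c) = 2 * (2 * c) := by linear_combination (-4) * h6
          rw [h2c] at h7
          exact one_ne_zero (α := F) (by linear_combination -h7)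
        · rw [hx, hy, add_zero]
      have : Subsingleton A := ⟨fun x y => by rw [hzero x, hzero y]⟩
      simp [Module.finrank_zero_of_subsingleton]
  · left
    intro h x hx
    have h1 := congrArg (π (g + h)) (hvv x)
    rw [hne (g + (g + h)) (g + h) (by simpa using hg) _ (hdeg _ _ (hdeg _ _ hx)), map_add,
      map_smul, map_smul, hne h (g + h) (by simpa using hg) _ hx, smul_zero, add_zero,
      hsame _ _ (hdeg _ _ hx)] at h1
    have h2 := (smul_eq_zero.1 h1.symm).resolve_left (sub_ne_zero.2 (Ne.symm h2c))
    rw [hv, sub_eq_zero] at h2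
    rw [h2]
    exact Submodule.smul_mem _ _ hx

end Module

section Algebra

variable [AddCommGroup G] [NonUnitalNonAssocRing A] [Module F A] {𝒜 : G → Submodule F A}

/-- The homogeneous components of a centroid element belong to the centroid. -/
theorem exists_homogeneous_component_mem_centroid (hgr : IsGrading F 𝒜) {π : G → A →ₗ[F] A}
    (hsame : ∀ g, ∀ x ∈ 𝒜 g, π g x = x) (hne : ∀ g h, g ≠ h → ∀ x ∈ 𝒜 g, π h x = 0)
    {p : A →ₗ[F] A} (hl : ∀ x y, p (x * y) = p x * y) (hr : ∀ x y, p (x * y) = x * p y) (g : G) :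
    ∃ T : A →ₗ[F] A, (∀ h, ∀ x ∈ 𝒜 h, T x = π (g + h) (p x)) ∧
      (∀ x y, T (x * y) = T x * y) ∧ ∀ x y, T (x * y) = x * T y := by
  obtain ⟨hind, htop, hmul⟩ := hgr
  have hπl : ∀ m k y, y ∈ 𝒜 k → ∀ w, π (m + k) (w * y) = π m w * y := fun m k y hy => by
    refine induction_of_iSup_eq_top htop (fun n w hw => ?_) fun w z hw hz => ?_
    · by_cases hn : n = m
      · subst hn; rw [hsame _ _ (hmul hw hy), hsame _ _ hw]
      · rw [hne _ _ (by simpa using hn) _ (hmul hw hy), hne _ _ hn _ hw, zero_mul]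
    · rw [add_mul, map_add, map_add, add_mul, hw, hz]
  have hπr : ∀ m k y, y ∈ 𝒜 k → ∀ w, π (k + m) (y * w) = y * π m w := fun m k y hy => by
    refine induction_of_iSup_eq_top htop (fun n w hw => ?_) fun w z hw hz => ?_
    · by_cases hn : n = m
      · subst hn; rw [hsame _ _ (hmul hy hw), hsame _ _ hw]
      · rw [hne _ _ (by simpa using hn) _ (hmul hy hw), hne _ _ hn _ hw, mul_zero]
    · rw [mul_add, map_add, map_add, mul_add, hw, hz]
  obtain ⟨T, hT⟩ := exists_linearMap_eq_on_components hind htop fun h => π (g + h) ∘ₗ p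
  simp only [LinearMap.comp_apply] at hT
  refine ⟨T, hT, ?_, ?_⟩
  · refine induction_of_iSup_eq_top htop (fun h x hx => ?_) fun x z hx hz y => ?_
    · refine induction_of_iSup_eq_top htop (fun k y hy => ?_) fun y z hy hz => ?_
      · rw [hT _ _ (hmul hx hy), hT _ _ hx, hl, ← add_assoc, hπl _ _ _ hy]
      · rw [mul_add, map_add, hy, hz, mul_add]
    · rw [add_mul, map_add, hx, hz, map_add, add_mul]
  · refine induction_of_iSup_eq_top htop (fun h x hx => ?_) fun x z hx hz y => ?_
    · refine induction_of_iSup_eq_top htop (fun k y hy => ?_) fun y z hy hz => ?_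
      · rw [hT _ _ (hmul hx hy), hT _ _ hy, hr, add_left_comm, hπr _ _ _ hx]
      · rw [mul_add, map_add, hy, hz, map_add, mul_add]
    · rw [add_mul, map_add, hx, hz, add_mul]

/-- A centroid element acts on a central simple ideal as a scalar. -/
theorem exists_smul_eq_of_centroid {B : Submodule F A}
    (hid : ∀ x ∈ B, ∀ a : A, a * x ∈ B ∧ x * a ∈ B)
    (hnz : ∃ x ∈ B, ∃ y ∈ B, x * y ≠ 0)
    (hsimple : ∀ J : Submodule F A, J ≤ B →
      (∀ x ∈ J, ∀ a ∈ B, a * x ∈ J ∧ x * a ∈ J) → J = ⊥ ∨ J = B)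
    (hcentral : ∀ T : B →ₗ[F] B,
      (∀ (x y : B) (hxy : (x : A) * (y : A) ∈ B),
        ((T ⟨(x : A) * (y : A), hxy⟩ : A) = (T x : A) * (y : A) ∧
          (T ⟨(x : A) * (y : A), hxy⟩ : A) = (x : A) * (T y : A))) →
      ∃ c : F, ∀ x : B, (T x : A) = c • (x : A))
    (T : A →ₗ[F] A) (hl : ∀ x y, T (x * y) = T x * y) (hr : ∀ x y, T (x * y) = x * T y) :
    ∃ c : F, ∀ x ∈ B, T x = c • x := by
  let J : Submodule F A := Submodule.span F {z | ∃ x ∈ B, ∃ y ∈ B, x * y = z}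
  have hJB : J ≤ B := Submodule.span_le.2 (by
    rintro _ ⟨x, hx, y, hy, rfl⟩
    exact (hid y hy x).1)
  have hmemJ : ∀ x ∈ B, ∀ y ∈ B, x * y ∈ J := fun x hx y hy =>
    Submodule.subset_span ⟨x, hx, y, hy, rfl⟩
  have hJ : J = B := by
    refine (hsimple J hJB fun x hx a ha =>
      ⟨hmemJ a ha x (hJB hx), hmemJ x (hJB hx) a ha⟩).resolve_left fun h => ?_
    obtain ⟨x, hx, y, hy, hxy⟩ := hnz
    exact hxy ((Submodule.mem_bot F).1 (h ▸ hmemJ x hx y hy))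
  have hTB : ∀ x ∈ B, T x ∈ B := by
    have : J ≤ B.comap T := Submodule.span_le.2 (by
      rintro _ ⟨x, hx, y, hy, rfl⟩
      simpa [hl] using (hid y hy (T x)).1)
    rwa [hJ] at this
  obtain ⟨c, hc⟩ := hcentral (T.restrict hTB) fun x y hxy => ⟨hl x y, hr x y⟩
  exact ⟨c, fun x hx => hc ⟨x, hx⟩⟩

/-- The projection onto a direct summand ideal lies in the centroid. -/
theorem exists_projection_mem_centroid {A₁ A₂ : Submodule F A}
    (hid₁ : ∀ x ∈ A₁, ∀ a : A, a * x ∈ A₁ ∧ x * a ∈ A₁)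
    (hid₂ : ∀ x ∈ A₂, ∀ a : A, a * x ∈ A₂ ∧ x * a ∈ A₂) (hcompl : IsCompl A₁ A₂) :
    ∃ p : A →ₗ[F] A, (∀ x, p x ∈ A₁) ∧ (∀ x, x - p x ∈ A₂) ∧ (∀ x ∈ A₁, p x = x) ∧
      (∀ x ∈ A₂, p x = 0) ∧ (∀ x y, p (x * y) = p x * y) ∧ ∀ x y, p (x * y) = x * p y := by
  let p := A₁.projection A₂ hcompl
  have hp₁ : ∀ x, p x ∈ A₁ := Submodule.projection_apply_mem hcompl
  have hp₂ : ∀ x, x - p x ∈ A₂ := Submodule.sub_projection_mem hcompl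
  have hfix : ∀ x ∈ A₁, p x = x := fun x hx => Submodule.projection_apply_of_mem_left hcompl hx
  have hker : ∀ x ∈ A₂, p x = 0 := fun x hx =>
    (Submodule.projection_apply_eq_zero_iff hcompl).2 hx
  refine ⟨p, hp₁, hp₂, hfix, hker, fun x y => ?_, fun x y => ?_⟩
  · have h : x * y = p x * y + (x - p x) * y := by rw [← add_mul, add_sub_cancel]
    rw [h, map_add, hfix _ (hid₁ _ (hp₁ x) y).2, hker _ (hid₂ _ (hp₂ x) y).2, add_zero]
  · have h : x * y = x * p y + x * (y - p y) := by rw [← mul_add, add_sub_cancel]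
    rw [h, map_add, hfix _ (hid₁ _ (hp₁ y) x).1, hker _ (hid₂ _ (hp₂ y) x).1, add_zero]

end Algebra

end GradedLinearAlgebra

/-- Let `A` be a finite-dimensional `G`-graded `F`-algebra which decomposes
as `A = A₁ ⊕ A₂` for two-sided ideals `A₁`, `A₂`, each of which is a central simple algebra
(simple: nonzero product and no proper nonzero ideals; central: every element of the
centroid is a scalar multiple of the identity).  If `dim A₁ ≠ dim A₂` then `A₁` and `A₂`
are graded subspaces of `A`. -/
theorem ideals_isGradedSubspace_of_central_simple (F : Type*) [Field F]
    (G : Type*) [AddCommGroup G] (A : Type*) [NonUnitalNonAssocRing A] [Module F A]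
    [FiniteDimensional F A]
    (𝒜 : G → Submodule F A) (hgr : IsGrading F 𝒜)
    (A₁ A₂ : Submodule F A)
    -- `A₁` and `A₂` are two-sided ideals of `A`:
    (hid₁ : ∀ x ∈ A₁, ∀ a : A, a * x ∈ A₁ ∧ x * a ∈ A₁)
    (hid₂ : ∀ x ∈ A₂, ∀ a : A, a * x ∈ A₂ ∧ x * a ∈ A₂)
    -- `A = A₁ ⊕ A₂`:
    (hcompl : IsCompl A₁ A₂)
    -- `A₁ A₁ ≠ 0` and `A₂ A₂ ≠ 0`:
    (hnz₁ : ∃ x ∈ A₁, ∃ y ∈ A₁, x * y ≠ 0)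
    (hnz₂ : ∃ x ∈ A₂, ∃ y ∈ A₂, x * y ≠ 0)
    -- `A₁`, `A₂` are simple algebras:
    (hsimple₁ : ∀ J : Submodule F A, J ≤ A₁ →
      (∀ x ∈ J, ∀ a ∈ A₁, a * x ∈ J ∧ x * a ∈ J) → J = ⊥ ∨ J = A₁)
    (hsimple₂ : ∀ J : Submodule F A, J ≤ A₂ →
      (∀ x ∈ J, ∀ a ∈ A₂, a * x ∈ J ∧ x * a ∈ J) → J = ⊥ ∨ J = A₂)
    -- `A₁`, `A₂` are central: every centroid element is a scalar:
    (hcentral₁ : ∀ T : A₁ →ₗ[F] A₁,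
      (∀ (x y : A₁) (hxy : (x : A) * (y : A) ∈ A₁),
        ((T ⟨(x : A) * (y : A), hxy⟩ : A) = (T x : A) * (y : A) ∧
          (T ⟨(x : A) * (y : A), hxy⟩ : A) = (x : A) * (T y : A))) →
      ∃ c : F, ∀ x : A₁, (T x : A) = c • (x : A))
    (hcentral₂ : ∀ T : A₂ →ₗ[F] A₂,
      (∀ (x y : A₂) (hxy : (x : A) * (y : A) ∈ A₂),
        ((T ⟨(x : A) * (y : A), hxy⟩ : A) = (T x : A) * (y : A) ∧
          (T ⟨(x : A) * (y : A), hxy⟩ : A) = (x : A) * (T y : A))) →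
      ∃ c : F, ∀ x : A₂, (T x : A) = c • (x : A))
    -- the dimensions differ:
    (hdim : Module.finrank F A₁ ≠ Module.finrank F A₂) :
    IsGradedSubspace F 𝒜 A₁ ∧ IsGradedSubspace F 𝒜 A₂ := by
  obtain ⟨p, hp₁, hp₂, hfix, hker, hl, hr⟩ := exists_projection_mem_centroid hid₁ hid₂ hcompl
  obtain ⟨hind, htop, -⟩ := id hgr
  replace hind : iSupIndep 𝒜 := hind
  obtain ⟨π, hmem, hsame, hne⟩ := exists_component_projections hind htop
  have hdeg : ∀ h, ∀ x ∈ 𝒜 h, p x ∈ 𝒜 h := by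
    choose T hT hTl hTr using exists_homogeneous_component_mem_centroid hgr hsame hne hl hr
    choose a ha using fun g =>
      exists_smul_eq_of_centroid hid₁ hnz₁ hsimple₁ hcentral₁ (T g) (hTl g) (hTr g)
    choose b hb using fun g =>
      exists_smul_eq_of_centroid hid₂ hnz₂ hsimple₂ hcentral₂ (T g) (hTl g) (hTr g)
    have hTp : ∀ g x, T g x = (a g - b g) • p x + b g • x := fun g x => by
      have h1 : T g x = T g (p x) + T g (x - p x) := by rw [← map_add, add_sub_cancel]
      rw [h1, ha g _ (hp₁ x), hb g _ (hp₂ x)]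
      module
    by_cases hab : ∀ g, g ≠ 0 → a g = b g
    · intro h x hx
      refine mem_of_projections_eq_zero htop hsame hne fun k hk => ?_
      have hT' : π k (p x) = b (k - h) • x := by
        have h1 := hT (k - h) h x hx
        rw [sub_add_cancel] at h1
        rw [← h1, hTp, hab _ (sub_ne_zero.2 hk), sub_self, zero_smul, zero_add]
      rw [← hsame k _ (hmem k (p x)), hT', map_smul, hne h k hk.symm x hx, smul_zero]
    · push Not at hab
      obtain ⟨g, hg, hgab⟩ := hab
      refine (map_mem_or_finrank_eq_of_shift hind htop (p := p) (V := A₁) (W := A₂)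
        (fun x => hfix _ (hp₁ x)) (fun x => ⟨hfix x, fun h => h ▸ hp₁ x⟩)
        (fun x => ⟨hker x, fun h => by simpa [h] using hp₂ x⟩) hg
        (c := -((a g - b g)⁻¹ * b g)) fun h x hx => ?_).resolve_right hdim
      have h1 : p x - (-((a g - b g)⁻¹ * b g)) • x = (a g - b g)⁻¹ • T g x := by
        rw [hTp, smul_add, inv_smul_smul₀ (sub_ne_zero.2 hgab), smul_smul, neg_smul, sub_neg_eq_add]
      rw [h1, hT g h x hx]
      exact Submodule.smul_mem _ _ (hmem _ _)
  refine ⟨eq_iSup_inf_of_map_mem htop p hp₁ hfix hdeg,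
    eq_iSup_inf_of_map_mem htop (LinearMap.id - p) hp₂ (fun x hx => ?_) fun g x hx => ?_⟩
  · simp [hker x hx]
  · exact sub_mem hx (hdeg g x hx)
end
end

section
/- Assume F is algebraically closed of characteristic different from 2, let C be the Cayley algebra over F, and let G be an abelian group. (i) If Γ is a G-grading on the direct product algebra C×C such that C×0 and 0×C are graded subspaces, then Γ is isomorphic to a product grading Γ¹×_G Γ², defined by (C×C)_g = (C_g)×(C'_g), for some G-gradings Γ¹: C = ⊕_g C_g and Γ²: C = ⊕_g C'_g. (ii) Two product gradings Γ¹×_G Γ² and Γ'¹×_G Γ'² on C×C are isomorphic if and only if either (Γ¹ ≅ Γ'¹ and Γ² ≅ Γ'²) or (Γ¹ ≅ Γ'² and Γ² ≅ Γ'¹), where isomorphism of two G-gradings on an algebra means an algebra automorphism mapping each homogeneous component of the first onto the component of the same degree of the second. -/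
noncomputable section

section Hurwitz

variable {F : Type*} [Field F] {C : Type*} [NonAssocRing C] [Module F C] {n : QuadraticForm F C}

theorem polar_mul_mul_left (hn : ∀ x y : C, n (x * y) = n x * n y) (x a b : C) :
    QuadraticMap.polar n (x * a) (x * b) = n x * QuadraticMap.polar n a b := by
  simp only [QuadraticMap.polar, ← mul_add, hn]
  ring

theorem polar_mul_mul_add (hn : ∀ x y : C, n (x * y) = n x * n y) (x y a b : C) :
    QuadraticMap.polar n (x * a) (y * b) + QuadraticMap.polar n (y * a) (x * b) =
      QuadraticMap.polar n x y * QuadraticMap.polar n a b := by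
  have h := polar_mul_mul_left hn (x + y) a b
  simp only [add_mul, QuadraticMap.polar_add_left, QuadraticMap.polar_add_right,
    polar_mul_mul_left hn] at h
  have h2 : QuadraticMap.polar n x y = n (x + y) - n x - n y := rfl
  rw [h2]
  linear_combination h

theorem IsHurwitz.eq_zero_of_mul_eq_zero (hC : IsHurwitz F n) {x y : C} (hx : n x ≠ 0)
    (h : x * y = 0) : y = 0 := by
  refine hC.2.1 y fun z => ?_
  have h1 := polar_mul_mul_left hC.2.2 x y z
  rw [h, QuadraticMap.polar_zero_left] at h1
  exact (mul_eq_zero.mp h1.symm).resolve_left hx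

/-- An isotropic element `x` satisfies `x² = n(x,1) x`. -/
theorem IsHurwitz.mul_self_of_isotropic (hC : IsHurwitz F n) {x : C} (hx : n x = 0) :
    x * x = QuadraticMap.polar n x 1 • x := by
  rw [← sub_eq_zero]
  refine hC.2.1 _ fun w => ?_
  have h1 := polar_mul_mul_add hC.2.2 x 1 x w
  have h2 := polar_mul_mul_left hC.2.2 x 1 w
  rw [mul_one, hx, zero_mul] at h2
  simp only [one_mul, h2, add_zero] at h1
  rw [QuadraticMap.polar_sub_left, QuadraticMap.polar_smul_left, h1, smul_eq_mul, sub_self]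

/-- If `C` is the sum of two mutually annihilating images and the units of both images are
isotropic, then the first image is spanned by its unit. -/
theorem IsHurwitz.mem_span_unit [SMulCommClass F C C] (hC : IsHurwitz F n) {f g : C →ₗ[F] C}
    (hf : ∀ x y, f (x * y) = f x * f y) (hg : ∀ x y, g (x * y) = g x * g y)
    (hgf : ∀ x y, g x * f y = 0) (hsum : ∀ c, ∃ a b, f a + g b = c) (he : n (f 1) = 0) (he' : n (g 1) = 0) (a : C) :
    ∃ t : F, t • f 1 = f a := by
  by_cases hx : f a = 0
  · exact ⟨0, by simp [hx]⟩
  have hfa : n (f a) = 0 := by rw [← one_mul a, hf, hC.2.2, he, zero_mul]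
  obtain ⟨d, hd⟩ : ∃ d, QuadraticMap.polar n (f a) (g d) ≠ 0 := by
    by_contra! h
    refine hx (hC.2.1 _ fun w => ?_)
    obtain ⟨c, d, rfl⟩ := hsum w
    rw [QuadraticMap.polar_add_right, h, add_zero, ← one_mul a, ← one_mul c, hf, hf,
      polar_mul_mul_left hC.2.2, he, zero_mul]
  have hgd : n (g d) = 0 := by rw [← one_mul d, hg, hC.2.2, he', zero_mul]
  have hne : n (f a + g d) ≠ 0 := by
    simpa [QuadraticMap.polar, hfa, hgd] using hd
  refine ⟨QuadraticMap.polar n (f a) 1, (sub_eq_zero.mp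
    (hC.eq_zero_of_mul_eq_zero (y := f a - QuadraticMap.polar n (f a) 1 • f 1) hne ?_)).symm⟩
  rw [add_mul, mul_sub, mul_sub, mul_smul_comm, mul_smul_comm, hgf, hgf, ← hf a 1, mul_one,
    hC.mul_self_of_isotropic hfa]
  simp

/-- A Hurwitz algebra of dimension greater than two is not a direct product in a nontrivial
way. -/
theorem IsHurwitz.eq_zero_or_eq_zero [SMulCommClass F C C] (hC : IsHurwitz F n)
    (hdim : 2 < Module.finrank F C) {f g : C →ₗ[F] C}
    (hf : ∀ x y, f (x * y) = f x * f y) (hg : ∀ x y, g (x * y) = g x * g y)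
    (hfg : ∀ x y, f x * g y = 0) (hgf : ∀ x y, g x * f y = 0)
    (hsum : ∀ c, ∃ a b, f a + g b = c) : f = 0 ∨ g = 0 := by
  by_cases he : n (f 1) = 0
  · by_cases he' : n (g 1) = 0
    · exfalso
      have htop : Submodule.span F {f 1, g 1} = ⊤ := by
        refine eq_top_iff.mpr fun c _ => ?_
        obtain ⟨a, b, rfl⟩ := hsum c
        obtain ⟨s, hs⟩ := hC.mem_span_unit hf hg hgf hsum he he' a
        obtain ⟨t, ht⟩ := hC.mem_span_unit hg hf hfg
          (fun c => by
            obtain ⟨a, b, h⟩ := hsum c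
            exact ⟨b, a, by rw [add_comm, h]⟩) he' he b
        exact Submodule.mem_span_pair.mpr ⟨s, t, by rw [hs, ht]⟩
      classical
      have h := finrank_span_finset_le_card (R := F) ({f 1, g 1} : Finset C)
      rw [Finset.coe_pair, Set.finrank, htop, finrank_top] at h
      have := Finset.card_le_two (a := f 1) (b := g 1)
      omega
    · exact Or.inl (LinearMap.ext fun a => hC.eq_zero_of_mul_eq_zero he' (hgf 1 a))
  · exact Or.inr (LinearMap.ext fun a => hC.eq_zero_of_mul_eq_zero he (hfg 1 a))

/-- An automorphism of `C × C` preserves or swaps the two factors. -/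
theorem IsHurwitz.aut_prod_self [SMulCommClass F C C] (hC : IsHurwitz F n)
    (hdim : 2 < Module.finrank F C) (φ : (C × C) ≃ₗ[F] (C × C))
    (hφ : ∀ x y, φ (x * y) = φ x * φ y) :
    ((∀ b, (φ (0, b)).1 = 0) ∧ ∀ a, (φ (a, 0)).2 = 0) ∨
      ((∀ a, (φ (a, 0)).1 = 0) ∧ ∀ b, (φ (0, b)).2 = 0) := by
  have key (p : C × C →ₗ[F] C) (hp : ∀ x y, p (x * y) = p x * p y)
      (hps : Function.Surjective p) :
      (∀ a, p (φ (a, 0)) = 0) ∨ ∀ b, p (φ (0, b)) = 0 := by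
    have h := hC.eq_zero_or_eq_zero hdim
      (f := p ∘ₗ φ.toLinearMap ∘ₗ LinearMap.inl F C C)
      (g := p ∘ₗ φ.toLinearMap ∘ₗ LinearMap.inr F C C)
      (fun x y => by simp [← hp, ← hφ]) (fun x y => by simp [← hp, ← hφ])
      (fun x y => by simp [← hp, ← hφ, ← Prod.zero_eq_mk])
      (fun x y => by simp [← hp, ← hφ, ← Prod.zero_eq_mk])
      (fun c => by
        obtain ⟨y, rfl⟩ := hps c
        refine ⟨(φ.symm y).1, (φ.symm y).2, ?_⟩
        simp [← map_add])
    exact h.imp (fun h a => LinearMap.congr_fun h a) (fun h a => LinearMap.congr_fun h a)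
  have hnt : Nontrivial C := Module.nontrivial_of_finrank_pos (R := F) (by omega)
  rcases key (LinearMap.fst F C C) (fun _ _ => rfl) Prod.fst_surjective with h1 | h1 <;>
    rcases key (LinearMap.snd F C C) (fun _ _ => rfl) Prod.snd_surjective with h2 | h2
  · have : φ (1, 0) = 0 := Prod.ext (h1 1) (h2 1)
    simp at this
  · exact Or.inr ⟨h1, h2⟩
  · exact Or.inl ⟨h1, h2⟩
  · have : φ (0, 1) = 0 := Prod.ext (h1 1) (h2 1)
    simp at this

end Hurwitz

section Product

variable {F : Type*} [Field F] {G : Type*} {C : Type*} [NonAssocRing C] [Module F C]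

/-- An isomorphism of product gradings that preserves the factors is a pair of isomorphisms. -/
theorem exists_equivs_of_preserves_factors {𝒞 𝒞' 𝒟 𝒟' : G → Submodule F C}
    (φ : (C × C) ≃ₗ[F] (C × C)) (hφ : ∀ x y, φ (x * y) = φ x * φ y)
    (hmap : ∀ g : G, ((𝒞 g).prod (𝒞' g)).map φ.toLinearMap = (𝒟 g).prod (𝒟' g))
    (h1 : ∀ b, (φ (0, b)).1 = 0) (h2 : ∀ a, (φ (a, 0)).2 = 0) :
    (∃ ψ : C ≃ₗ[F] C, (∀ x y, ψ (x * y) = ψ x * ψ y) ∧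
        ∀ g : G, (𝒞 g).map ψ.toLinearMap = 𝒟 g) ∧
      (∃ ψ : C ≃ₗ[F] C, (∀ x y, ψ (x * y) = ψ x * ψ y) ∧
        ∀ g : G, (𝒞' g).map ψ.toLinearMap = 𝒟' g) := by
  have hfst (x : C × C) : (φ x).1 = (φ (x.1, 0)).1 := by
    conv_lhs => rw [← Prod.fst_add_snd x, map_add, Prod.fst_add, h1, add_zero]
  have hsnd (x : C × C) : (φ x).2 = (φ (0, x.2)).2 := by
    conv_lhs => rw [← Prod.fst_add_snd x, map_add, Prod.snd_add, h2, zero_add]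
  have hbij1 : Function.Bijective
      (LinearMap.fst F C C ∘ₗ φ.toLinearMap ∘ₗ LinearMap.inl F C C) := by
    refine ⟨(injective_iff_map_eq_zero _).mpr fun a ha => ?_, fun c => ?_⟩
    · have : φ (a, 0) = 0 := Prod.ext ha (h2 a)
      simpa using this
    · refine ⟨(φ.symm (c, 0)).1, ?_⟩
      have := hfst (φ.symm (c, 0))
      simpa using this.symm
  have hbij2 : Function.Bijective
      (LinearMap.snd F C C ∘ₗ φ.toLinearMap ∘ₗ LinearMap.inr F C C) := by
    refine ⟨(injective_iff_map_eq_zero _).mpr fun a ha => ?_, fun c => ?_⟩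
    · have : φ (0, a) = 0 := Prod.ext (h1 a) ha
      simpa using this
    · refine ⟨(φ.symm (0, c)).2, ?_⟩
      have := hsnd (φ.symm (0, c))
      simpa using this.symm
  refine ⟨⟨LinearEquiv.ofBijective _ hbij1, fun x y => ?_, fun g => ?_⟩,
    ⟨LinearEquiv.ofBijective _ hbij2, fun x y => ?_, fun g => ?_⟩⟩
  · simp [← Prod.fst_mul, ← hφ]
  · ext c
    constructor
    · rintro ⟨a, ha, rfl⟩
      have : φ (a, 0) ∈ (𝒟 g).prod (𝒟' g) :=
        hmap g ▸ ⟨(a, 0), ⟨ha, (𝒞' g).zero_mem⟩, rfl⟩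
      exact this.1
    · intro hc
      have : (c, 0) ∈ ((𝒞 g).prod (𝒞' g)).map φ.toLinearMap :=
        (hmap g).symm ▸ ⟨hc, (𝒟' g).zero_mem⟩
      obtain ⟨x, hx, hxc⟩ := this
      refine ⟨x.1, hx.1, ?_⟩
      exact (hfst x).symm.trans (congrArg Prod.fst hxc)
  · simp [← Prod.snd_mul, ← hφ]
  · ext c
    constructor
    · rintro ⟨a, ha, rfl⟩
      have : φ (0, a) ∈ (𝒟 g).prod (𝒟' g) :=
        hmap g ▸ ⟨(0, a), ⟨(𝒞 g).zero_mem, ha⟩, rfl⟩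
      exact this.2
    · intro hc
      have : (0, c) ∈ ((𝒞 g).prod (𝒞' g)).map φ.toLinearMap :=
        (hmap g).symm ▸ ⟨(𝒟 g).zero_mem, hc⟩
      obtain ⟨x, hx, hxc⟩ := this
      refine ⟨x.2, hx.2, ?_⟩
      exact (hsnd x).symm.trans (congrArg Prod.snd hxc)

theorem map_prodComm_prod (p q : Submodule F C) :
    (p.prod q).map (LinearEquiv.prodComm F C C).toLinearMap = q.prod p := by
  ext ⟨a, b⟩
  constructor
  · rintro ⟨x, hx, h⟩
    obtain ⟨rfl, rfl⟩ := Prod.mk.inj h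
    exact ⟨hx.2, hx.1⟩
  · rintro ⟨ha, hb⟩
    exact ⟨(b, a), ⟨hb, ha⟩, rfl⟩

/-- The swap turns an isomorphism onto `𝒟 × 𝒟'` into one onto `𝒟' × 𝒟`. -/
theorem map_trans_prodComm {p p' q q' : Submodule F C} {φ : (C × C) ≃ₗ[F] (C × C)}
    (h : (p.prod p').map φ.toLinearMap = q.prod q') :
    (p.prod p').map (φ.trans (LinearEquiv.prodComm F C C)).toLinearMap = q'.prod q := by
  rw [← map_prodComm_prod q q', ← h, ← Submodule.map_comp]
  rfl

theorem map_prodCongr_prod {p p' q q' : Submodule F C} {ψ ψ' : C ≃ₗ[F] C}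
    (h : p.map ψ.toLinearMap = q) (h' : p'.map ψ'.toLinearMap = q') :
    (p.prod p').map (ψ.prodCongr ψ').toLinearMap = q.prod q' := by
  subst h h'
  ext ⟨a, b⟩
  constructor
  · rintro ⟨x, hx, h⟩
    obtain ⟨rfl, rfl⟩ := Prod.mk.inj h
    exact ⟨⟨_, hx.1, rfl⟩, ⟨_, hx.2, rfl⟩⟩
  · rintro ⟨⟨x, hx, hxa⟩, ⟨y, hy, hyb⟩⟩
    exact ⟨(x, y), ⟨hx, hy⟩, Prod.ext hxa hyb⟩

end Product

section Gradings

variable {F : Type*} [Field F] {G : Type*}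

theorem eq_of_le_of_iSup_eq_top {V : Type*} [AddCommGroup V] [Module F V]
    {𝒜 ℬ : G → Submodule F V}
    (hdisj : ∀ g : G, Disjoint (𝒜 g) (⨆ h : G, ⨆ _ : h ≠ g, 𝒜 h))
    (hle : ∀ g, ℬ g ≤ 𝒜 g) (htop : ⨆ g, ℬ g = ⊤) (g : G) : 𝒜 g = ℬ g := by
  refine le_antisymm (fun x hx => ?_) (hle g)
  have hx' : x ∈ ℬ g ⊔ ⨆ h : G, ⨆ _ : h ≠ g, 𝒜 h := by
    have : (⨆ g, ℬ g) ≤ ℬ g ⊔ ⨆ h : G, ⨆ _ : h ≠ g, 𝒜 h := iSup_le fun h => by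
      by_cases hh : h = g
      · exact hh ▸ le_sup_left
      · exact le_sup_of_le_right (le_iSup₂_of_le h hh (hle h))
    exact this (htop ▸ Submodule.mem_top)
  obtain ⟨b, hb, r, hr, rfl⟩ := Submodule.mem_sup.mp hx'
  have hr' : r ∈ 𝒜 g := by
    simpa using (𝒜 g).sub_mem hx (hle g hb)
  rw [Submodule.disjoint_def.mp (hdisj g) r hr' hr, add_zero]
  exact hb

/-- A grading restricts along an injective homomorphism whose range is a graded subspace. -/
theorem IsGrading.comap [AddCommGroup G] {A B : Type*} [NonUnitalNonAssocRing A] [Module F A]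
    [NonUnitalNonAssocRing B] [Module F B] {𝒜 : G → Submodule F A} (h𝒜 : IsGrading F 𝒜)
    (i : B →ₗ[F] A) (hi : Function.Injective i) (hmul : ∀ x y, i (x * y) = i x * i y)
    (hgr : IsGradedSubspace F 𝒜 (LinearMap.range i)) :
    IsGrading F fun g => (𝒜 g).comap i := by
  refine ⟨fun g => ?_, ?_, fun g h x y hx hy => ?_⟩
  · rw [Submodule.disjoint_def]
    intro x hx hx'
    refine hi ?_
    rw [map_zero]
    refine Submodule.disjoint_def.mp (h𝒜.1 g) _ hx ?_
    have hle : (⨆ h : G, ⨆ _ : h ≠ g, (𝒜 h).comap i) ≤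
        (⨆ h : G, ⨆ _ : h ≠ g, 𝒜 h).comap i :=
      iSup₂_le fun h hh => Submodule.comap_mono (le_iSup₂_of_le h hh le_rfl)
    exact hle hx'
  · refine Submodule.map_injective_of_injective hi ?_
    rw [Submodule.map_iSup, Submodule.map_top, hgr]
    exact iSup_congr fun g => Submodule.map_comap_eq _ _
  · rw [Submodule.mem_comap, hmul]
    exact h𝒜.2.2 hx hy

end Gradings

/-- Over an algebraically closed field `F` of characteristic `≠ 2`, let
`C` be the Cayley algebra and `G` an abelian group.
(i) Every `G`-grading on `C × C` for which `C × 0` and `0 × C` are graded subspaces is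
isomorphic to a product grading `Γ¹ ×_G Γ²` of two `G`-gradings on `C`.
(ii) Two product gradings `Γ¹ ×_G Γ²` and `Γ'¹ ×_G Γ'²` on `C × C` are isomorphic iff
`Γ¹ ≅ Γ'¹` and `Γ² ≅ Γ'²`, or `Γ¹ ≅ Γ'²` and `Γ² ≅ Γ'¹`. -/
theorem product_gradings_on_cayley_square (F : Type*) [Field F] [IsAlgClosed F]
    (hF : (2 : F) ≠ 0) (G : Type*) [AddCommGroup G]
    (C : Type*) [NonAssocRing C] [Module F C] [SMulCommClass F C C] [IsScalarTower F C C]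
    (n : QuadraticForm F C) (hC : IsHurwitz F n) (hdim : Module.finrank F C = 8) :
    (∀ 𝒜 : G → Submodule F (C × C), IsGrading F 𝒜 →
      IsGradedSubspace F 𝒜 (LinearMap.range (LinearMap.inl F C C)) →
      IsGradedSubspace F 𝒜 (LinearMap.range (LinearMap.inr F C C)) →
      ∃ (𝒞 𝒞' : G → Submodule F C), IsGrading F 𝒞 ∧ IsGrading F 𝒞' ∧
        ∃ φ : (C × C) ≃ₗ[F] (C × C), (∀ x y, φ (x * y) = φ x * φ y) ∧
          ∀ g : G, (𝒜 g).map φ.toLinearMap = (𝒞 g).prod (𝒞' g)) ∧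
    (∀ (𝒞 𝒞' 𝒟 𝒟' : G → Submodule F C), IsGrading F 𝒞 → IsGrading F 𝒞' →
      IsGrading F 𝒟 → IsGrading F 𝒟' →
      ((∃ φ : (C × C) ≃ₗ[F] (C × C), (∀ x y, φ (x * y) = φ x * φ y) ∧
          ∀ g : G, ((𝒞 g).prod (𝒞' g)).map φ.toLinearMap = (𝒟 g).prod (𝒟' g)) ↔
        (((∃ ψ : C ≃ₗ[F] C, (∀ x y, ψ (x * y) = ψ x * ψ y) ∧
              ∀ g : G, (𝒞 g).map ψ.toLinearMap = 𝒟 g) ∧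
           (∃ ψ : C ≃ₗ[F] C, (∀ x y, ψ (x * y) = ψ x * ψ y) ∧
              ∀ g : G, (𝒞' g).map ψ.toLinearMap = 𝒟' g)) ∨
         ((∃ ψ : C ≃ₗ[F] C, (∀ x y, ψ (x * y) = ψ x * ψ y) ∧
              ∀ g : G, (𝒞 g).map ψ.toLinearMap = 𝒟' g) ∧
           (∃ ψ : C ≃ₗ[F] C, (∀ x y, ψ (x * y) = ψ x * ψ y) ∧
              ∀ g : G, (𝒞' g).map ψ.toLinearMap = 𝒟 g))))) := by
  have hdim2 : 2 < Module.finrank F C := by omega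
  refine ⟨fun 𝒜 h𝒜 hl hr => ?_, fun 𝒞 𝒞' 𝒟 𝒟' _ _ _ _ => ⟨?_, ?_⟩⟩
  · have h1 := h𝒜.comap (LinearMap.inl F C C) LinearMap.inl_injective
      (fun x y => by simp) hl
    have h2 := h𝒜.comap (LinearMap.inr F C C) LinearMap.inr_injective
      (fun x y => by simp) hr
    refine ⟨_, _, h1, h2, LinearEquiv.refl F _, fun _ _ => rfl, fun g => ?_⟩
    refine (Submodule.map_id _).trans (eq_of_le_of_iSup_eq_top
      (ℬ := fun g => ((𝒜 g).comap (LinearMap.inl F C C)).prod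
        ((𝒜 g).comap (LinearMap.inr F C C))) h𝒜.1 (fun g x hx => ?_) ?_ g)
    · rw [← Prod.fst_add_snd x]
      exact (𝒜 g).add_mem hx.1 hx.2
    · rw [eq_top_iff, ← LinearMap.sup_range_inl_inr,
        ← Submodule.map_top (LinearMap.inl F C C), ← h1.2.1,
        ← Submodule.map_top (LinearMap.inr F C C), ← h2.2.1,
        Submodule.map_iSup, Submodule.map_iSup]
      refine sup_le (iSup_mono fun g => ?_) (iSup_mono fun g => ?_)
      · rintro _ ⟨x, hx, rfl⟩
        exact ⟨hx, Submodule.zero_mem _⟩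
      · rintro _ ⟨x, hx, rfl⟩
        exact ⟨Submodule.zero_mem _, hx⟩
  · rintro ⟨φ, hφ, hmap⟩
    rcases hC.aut_prod_self hdim2 φ hφ with ⟨h1, h2⟩ | ⟨h1, h2⟩
    · exact Or.inl (exists_equivs_of_preserves_factors φ hφ hmap h1 h2)
    · refine Or.inr (exists_equivs_of_preserves_factors
        (φ.trans (LinearEquiv.prodComm F C C)) (fun x y => ?_)
        (fun g => map_trans_prodComm (hmap g)) h2 h1)
      simp only [LinearEquiv.trans_apply, hφ]
      rfl
  · rintro (⟨⟨ψ, hψ, h⟩, ⟨ψ', hψ', h'⟩⟩ | ⟨⟨ψ, hψ, h⟩, ⟨ψ', hψ', h'⟩⟩)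
    · exact ⟨ψ.prodCongr ψ', fun x y => Prod.ext (hψ _ _) (hψ' _ _),
        fun g => map_prodCongr_prod (h g) (h' g)⟩
    · exact ⟨(ψ.prodCongr ψ').trans (LinearEquiv.prodComm F C C),
        fun x y => Prod.ext (hψ' _ _) (hψ _ _),
        fun g => map_trans_prodComm (map_prodCongr_prod (h g) (h' g))⟩
end
end

section
/- Let C be a Cayley algebra over F and T := T(C⊗C) the Smirnov algebra with involution. Let G be any group, not necessarily abelian, and let T = ⊕_{g∈G} T_g be a vector space decomposition with T_g T_h ⊆ T_{gh} for all g,h ∈ G that preserves the involution. Then the elements of the support {g ∈ G : T_g ≠ 0} pairwise commute; in particular the subgroup of G generated by the support is abelian. -/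
open scoped TensorProduct

noncomputable section

/-- The Smirnov algebra `T(C⊗C) = span{ a⊗a - n(a)·1⊗1 : a ∈ C } ⊆ C ⊗ C`. -/
def smirnovT (F : Type*) [Field F] {C : Type*} [NonAssocRing C] [Module F C]
    (n : QuadraticForm F C) : Submodule F (C ⊗[F] C) :=
  Submodule.span F {x : C ⊗[F] C | ∃ a : C, x = a ⊗ₜ[F] a - n a • ((1 : C) ⊗ₜ[F] (1 : C))}

/-- The involution `σ` of `C ⊗ C`: the tensor product of the standard involutions. -/
def sigmaT (F : Type*) [Field F] {C : Type*} [NonAssocRing C] [Module F C]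
    (n : QuadraticForm F C) : C ⊗[F] C →ₗ[F] C ⊗[F] C :=
  TensorProduct.map (hconj F n) (hconj F n)

section Hurwitz

variable {F : Type*} [Field F] {C : Type*} [NonAssocRing C] [Module F C]

lemma IsHurwitz.map_one_s15 [Nontrivial C] {n : QuadraticForm F C} (hC : IsHurwitz F n) :
    n 1 = 1 := by
  obtain ⟨-, hnd, hm⟩ := hC
  have h1 : n 1 * n 1 = n 1 := by rw [← hm, one_mul]
  rcases eq_or_ne (n 1) 0 with h0 | h0
  · have hz : ∀ x, n x = 0 := fun x => by rw [← mul_one x, hm, h0, mul_zero]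
    exact absurd (hnd 1 fun y => by simp [QuadraticMap.polar, hz]) one_ne_zero
  · exact mul_left_cancel₀ h0 (h1.trans (mul_one _).symm)

lemma IsHurwitz.polar_one_one_s15 [Nontrivial C] {n : QuadraticForm F C} (hC : IsHurwitz F n) :
    QuadraticMap.polar n 1 1 = 2 := by
  rw [QuadraticMap.polar_self, hC.map_one_s15, nsmul_eq_mul, Nat.cast_ofNat, mul_one]

lemma IsHurwitz.polar_mul_right_s15 {n : QuadraticForm F C} (hC : IsHurwitz F n) (x y z : C) :
    QuadraticMap.polar n (x * z) (y * z) = QuadraticMap.polar n x y * n z := by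
  simp only [QuadraticMap.polar, ← add_mul, hC.2.2]
  ring

lemma IsHurwitz.polar_mul_mul {n : QuadraticForm F C} (hC : IsHurwitz F n) (x y z w : C) :
    QuadraticMap.polar n (x * y) (z * w) + QuadraticMap.polar n (x * w) (z * y) =
      QuadraticMap.polar n x z * QuadraticMap.polar n y w := by
  have h := hC.polar_mul_right_s15 x z (y + w)
  simp only [mul_add, QuadraticMap.polar_add_left, QuadraticMap.polar_add_right,
    hC.polar_mul_right_s15] at h
  have h2 : n (y + w) = n y + n w + QuadraticMap.polar n y w := by
    simp only [QuadraticMap.polar]; ring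
  rw [h2] at h
  linear_combination h

/-- On trace zero elements, the trace of a product is minus the polar form. -/
lemma IsHurwitz.polar_mul_one {n : QuadraticForm F C} (hC : IsHurwitz F n) {u : C} (v : C)
    (hu : QuadraticMap.polar n u 1 = 0) :
    QuadraticMap.polar n (u * v) 1 = -QuadraticMap.polar n u v := by
  have h := hC.polar_mul_mul u v 1 1
  rw [mul_one, mul_one, one_mul, hu, zero_mul] at h
  exact eq_neg_of_add_eq_zero_left h

lemma hconj_apply (n : QuadraticForm F C) (x : C) :
    hconj F n x = QuadraticMap.polar n x 1 • (1 : C) - x := rfl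

lemma hconj_of_polar_one_eq_zero {n : QuadraticForm F C} {u : C}
    (hu : QuadraticMap.polar n u 1 = 0) : hconj F n u = -u := by
  rw [hconj_apply, hu, zero_smul, zero_sub]

lemma IsHurwitz.hconj_one [Nontrivial C] {n : QuadraticForm F C} (hC : IsHurwitz F n) :
    hconj F n 1 = 1 := by
  rw [hconj_apply, hC.polar_one_one_s15, two_smul, add_sub_cancel_right]

/-- The map `u ↦ 1 ⊗ u + u ⊗ 1`. -/
def symOne (F : Type*) [Field F] (C : Type*) [NonAssocRing C] [Module F C] :
    C →ₗ[F] C ⊗[F] C :=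
  TensorProduct.mk F C C 1 + (TensorProduct.mk F C C).flip 1

lemma symOne_apply (u : C) : symOne F C u = (1 : C) ⊗ₜ[F] u + u ⊗ₜ[F] (1 : C) := rfl

lemma sigmaT_tmul (n : QuadraticForm F C) (a b : C) :
    sigmaT F n (a ⊗ₜ[F] b) = hconj F n a ⊗ₜ[F] hconj F n b := rfl

lemma IsHurwitz.sigmaT_symOne [Nontrivial C] {n : QuadraticForm F C} (hC : IsHurwitz F n)
    {u : C} (hu : QuadraticMap.polar n u 1 = 0) :
    sigmaT F n (symOne F C u) = -symOne F C u := by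
  rw [symOne_apply, map_add, sigmaT_tmul, sigmaT_tmul, hC.hconj_one,
    hconj_of_polar_one_eq_zero hu, TensorProduct.tmul_neg, TensorProduct.neg_tmul, neg_add]

lemma IsHurwitz.symOne_mem_smirnovT [Nontrivial C] {n : QuadraticForm F C}
    (hC : IsHurwitz F n) {u : C} (hu : QuadraticMap.polar n u 1 = 0) :
    symOne F C u ∈ smirnovT F n := by
  have h1 : (1 + u) ⊗ₜ[F] (1 + u) - n (1 + u) • ((1 : C) ⊗ₜ[F] (1 : C)) ∈ smirnovT F n :=
    Submodule.subset_span ⟨_, rfl⟩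
  have h2 : u ⊗ₜ[F] u - n u • ((1 : C) ⊗ₜ[F] (1 : C)) ∈ smirnovT F n :=
    Submodule.subset_span ⟨_, rfl⟩
  have hn : n (1 + u) = 1 + n u := by
    rw [QuadraticMap.polar_comm, QuadraticMap.polar, hC.map_one_s15] at hu
    linear_combination hu
  convert sub_mem h1 h2 using 1
  rw [symOne_apply, hn]
  simp only [TensorProduct.add_tmul, TensorProduct.tmul_add, add_smul, one_smul]
  abel

/-- The skew part of an element of the Smirnov algebra has the form `1 ⊗ u + u ⊗ 1` with `u` of
trace zero. -/
lemma IsHurwitz.exists_sub_sigmaT_eq_symOne [Nontrivial C] {n : QuadraticForm F C}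
    (hC : IsHurwitz F n) (hF : (2 : F) ≠ 0) {x : C ⊗[F] C} (hx : x ∈ smirnovT F n) :
    ∃ u : C, QuadraticMap.polar n u 1 = 0 ∧ x - sigmaT F n x = symOne F C u := by
  induction hx using Submodule.span_induction with
  | mem x hx =>
    obtain ⟨a, rfl⟩ := hx
    set t := QuadraticMap.polar n a 1 with ht
    refine ⟨t • a - (t ^ 2 / 2) • (1 : C), ?_, ?_⟩
    · rw [QuadraticMap.polar_sub_left, QuadraticMap.polar_smul_left,
        QuadraticMap.polar_smul_left, hC.polar_one_one_s15, ← ht, smul_eq_mul, smul_eq_mul]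
      field_simp
      ring
    · rw [map_sub, map_smul, sigmaT_tmul, sigmaT_tmul, hC.hconj_one, hconj_apply, ← ht,
        symOne_apply]
      simp only [TensorProduct.sub_tmul, TensorProduct.tmul_sub, ← TensorProduct.smul_tmul',
        TensorProduct.tmul_smul]
      match_scalars <;> field_simp <;> ring
  | zero => exact ⟨0, by simp, by simp⟩
  | add x y _ _ hx hy =>
    obtain ⟨u, hu, hxu⟩ := hx
    obtain ⟨v, hv, hyv⟩ := hy
    refine ⟨u + v, by rw [QuadraticMap.polar_add_left, hu, hv, add_zero], ?_⟩
    rw [map_add, map_add, ← hxu, ← hyv]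
    abel
  | smul c x _ hx =>
    obtain ⟨u, hu, hxu⟩ := hx
    refine ⟨c • u, by rw [QuadraticMap.polar_smul_left, hu, smul_zero], ?_⟩
    rw [map_smul, map_smul, ← hxu, smul_sub]

lemma IsHurwitz.tmul_add_tmul_sub_ne_zero [Nontrivial C] {n : QuadraticForm F C}
    (hC : IsHurwitz F n) (hF : (2 : F) ≠ 0) {u v : C} (hu : QuadraticMap.polar n u 1 = 0)
    (hu0 : u ≠ 0) (hv0 : v ≠ 0) (c : F) :
    u ⊗ₜ[F] v + v ⊗ₜ[F] u - c • ((1 : C) ⊗ₜ[F] (1 : C)) ≠ 0 := by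
  intro h
  have hmem : u ∉ Submodule.span F {(1 : C)} := by
    rintro hmem
    obtain ⟨r, rfl⟩ := Submodule.mem_span_singleton.1 hmem
    rw [QuadraticMap.polar_smul_left, hC.polar_one_one_s15, smul_eq_mul] at hu
    rcases mul_eq_zero.1 hu with rfl | h2
    · exact hu0 (zero_smul _ _)
    · exact hF h2
  obtain ⟨f, hfu, hf⟩ := Submodule.exists_le_ker_of_notMem hmem
  have hf1 : f 1 = 0 := hf (Submodule.mem_span_singleton_self 1)
  have key := congrArg (TensorProduct.lid F C ∘ TensorProduct.map f LinearMap.id) h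
  simp [hf1] at key
  have key2 := congrArg f key
  simp only [map_add, map_smul, smul_eq_mul, map_zero] at key2
  have hfv : f v = 0 := by
    have : 2 * f u * f v = 0 := by linear_combination key2
    simpa [hF, hfu] using this
  rw [hfv, zero_smul, add_zero] at key
  exact (smul_ne_zero hfu hv0) key

variable [SMulCommClass F C C] [IsScalarTower F C C]

/-- Twice the symmetric part of the product `(1 ⊗ u + u ⊗ 1) (1 ⊗ v + v ⊗ 1)`. -/
lemma IsHurwitz.symOne_mul_symOne_add_sigmaT [Nontrivial C] {n : QuadraticForm F C}
    (hC : IsHurwitz F n) {u v : C} (hu : QuadraticMap.polar n u 1 = 0)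
    (hv : QuadraticMap.polar n v 1 = 0) :
    symOne F C u * symOne F C v + sigmaT F n (symOne F C u * symOne F C v) =
      (2 : F) • (u ⊗ₜ[F] v + v ⊗ₜ[F] u
        - QuadraticMap.polar n u v • ((1 : C) ⊗ₜ[F] (1 : C))) := by
  simp only [symOne_apply, add_mul, mul_add, Algebra.TensorProduct.tmul_mul_tmul, one_mul,
    mul_one, map_add, sigmaT_tmul, hC.hconj_one, hconj_of_polar_one_eq_zero hu,
    hconj_of_polar_one_eq_zero hv]
  rw [hconj_apply, hC.polar_mul_one v hu]
  simp only [TensorProduct.sub_tmul, TensorProduct.tmul_sub, ← TensorProduct.smul_tmul',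
    TensorProduct.tmul_smul, TensorProduct.neg_tmul, TensorProduct.tmul_neg]
  match_scalars <;> ring

/-- The Smirnov algebra is generated, as an algebra with involution, by the elements
`1 ⊗ u + u ⊗ 1` with `u` of trace zero. -/
lemma IsHurwitz.smirnovT_le [Nontrivial C] {n : QuadraticForm F C}
    (hC : IsHurwitz F n) (hF : (2 : F) ≠ 0) {W : Submodule F (C ⊗[F] C)}
    (hmul : ∀ x ∈ W, ∀ y ∈ W, x * y ∈ W) (hinv : ∀ x ∈ W, sigmaT F n x ∈ W)
    (hsym : ∀ u : C, QuadraticMap.polar n u 1 = 0 → symOne F C u ∈ W) :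
    smirnovT F n ≤ W := by
  refine Submodule.span_le.2 ?_
  rintro _ ⟨a, rfl⟩
  obtain ⟨α, hα⟩ : ∃ α : F, QuadraticMap.polar n a 1 = 2 * α :=
    ⟨QuadraticMap.polar n a 1 / 2, by field_simp⟩
  obtain ⟨v, rfl⟩ : ∃ v : C, a = α • 1 + v := ⟨a - α • 1, by abel⟩
  have hv : QuadraticMap.polar n v 1 = 0 := by
    rw [QuadraticMap.polar_add_left, QuadraticMap.polar_smul_left, hC.polar_one_one_s15,
      smul_eq_mul] at hα
    linear_combination hα
  have hs := hsym v hv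
  have h4 := add_mem (hmul _ hs _ hs) (hinv _ (hmul _ hs _ hs))
  rw [hC.symOne_mul_symOne_add_sigmaT hv hv] at h4
  have hn : n (α • 1 + v) = α ^ 2 + n v := by
    have h := QuadraticMap.polar_smul_left n α 1 v
    rw [QuadraticMap.polar_comm n 1 v, hv, smul_zero, QuadraticMap.polar,
      QuadraticMap.map_smul, hC.map_one_s15, smul_eq_mul] at h
    linear_combination h
  have hself : QuadraticMap.polar n v v = 2 * n v := by
    rw [QuadraticMap.polar_self, nsmul_eq_mul, Nat.cast_ofNat]
  rw [SetLike.mem_coe]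
  convert add_mem (W.smul_mem α hs) (W.smul_mem ((2 : F)⁻¹ * 2⁻¹) h4) using 1
  rw [hn, symOne_apply, hself]
  simp only [TensorProduct.add_tmul, TensorProduct.tmul_add, ← TensorProduct.smul_tmul',
    TensorProduct.tmul_smul]
  match_scalars <;> field_simp <;> ring

end Hurwitz

section Grading

variable {F : Type*} [Field F] {A : Type*} [NonUnitalNonAssocRing A] [Module F A]
  {G : Type*} [Group G]

/-- The sum of the components with degree in a subgroup is closed under multiplication. -/
lemma mul_mem_iSup_subgroup {𝒯 : G → Submodule F A}
    (hmul : ∀ ⦃g h : G⦄ ⦃x y : A⦄, x ∈ 𝒯 g → y ∈ 𝒯 h → x * y ∈ 𝒯 (g * h)) (N : Subgroup G)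
    {x y : A} (hx : x ∈ ⨆ k : N, 𝒯 k) (hy : y ∈ ⨆ k : N, 𝒯 k) :
    x * y ∈ ⨆ k : N, 𝒯 k := by
  induction hx using Submodule.iSup_induction' with
  | mem g x hx =>
    induction hy using Submodule.iSup_induction' with
    | mem h y hy => exact Submodule.mem_iSup_of_mem (g * h) (hmul hx hy)
    | zero => rw [mul_zero]; exact zero_mem _
    | add y z _ _ hy hz => rw [mul_add]; exact add_mem hy hz
  | zero => rw [zero_mul]; exact zero_mem _
  | add x z _ _ hx hz => rw [add_mul]; exact add_mem hx hz

end Grading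

/-- Let `C` be a Cayley algebra over a field `F` of characteristic `≠ 2`
and `T = T(C⊗C)` the Smirnov algebra with involution.  For any (not necessarily abelian)
group `G` and any involution preserving decomposition `T = ⊕_{g ∈ G} T_g` with
`T_g T_h ⊆ T_{gh}`, the elements of the support pairwise commute; in particular the
subgroup generated by the support is abelian. -/
theorem smirnov_grading_support_commutes (F : Type*) [Field F] (hF : (2 : F) ≠ 0)
    (C : Type*) [NonAssocRing C] [Module F C] [SMulCommClass F C C] [IsScalarTower F C C]
    (n : QuadraticForm F C) (hC : IsHurwitz F n) (hdim : Module.finrank F C = 8)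
    (G : Type*) [Group G] (𝒯 : G → Submodule F (C ⊗[F] C))
    (hle : ∀ g : G, 𝒯 g ≤ smirnovT F n)
    (hind : ∀ g : G, Disjoint (𝒯 g) (⨆ h : G, ⨆ _ : h ≠ g, 𝒯 h))
    (hsup : (⨆ g : G, 𝒯 g) = smirnovT F n)
    (hmul : ∀ ⦃g h : G⦄ ⦃x y : C ⊗[F] C⦄, x ∈ 𝒯 g → y ∈ 𝒯 h → x * y ∈ 𝒯 (g * h))
    (hinv : ∀ (g : G), ∀ x ∈ 𝒯 g, sigmaT F n x ∈ 𝒯 g) :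
    (∀ g h : G, 𝒯 g ≠ ⊥ → 𝒯 h ≠ ⊥ → g * h = h * g) ∧
      ∀ a ∈ Subgroup.closure {g : G | 𝒯 g ≠ ⊥}, ∀ b ∈ Subgroup.closure {g : G | 𝒯 g ≠ ⊥},
        a * b = b * a := by
  have : Nontrivial C := Module.nontrivial_of_finrank_pos (R := F) (by omega)
  set K : Set G := {g | ∃ u : C, u ≠ 0 ∧ QuadraticMap.polar n u 1 = 0 ∧ symOne F C u ∈ 𝒯 g}
  have hinf : ∀ {g h : G} {x : C ⊗[F] C}, x ≠ 0 → x ∈ 𝒯 g → x ∈ 𝒯 h → g = h := by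
    intro g h x hx0 hg hh
    by_contra hne
    exact hx0 (Submodule.disjoint_def.1 (hind g) x hg
      (Submodule.mem_iSup_of_mem h (Submodule.mem_iSup_of_mem (Ne.symm hne) hh)))
  have hKcomm : ∀ g ∈ K, ∀ h ∈ K, g * h = h * g := by
    rintro g ⟨u, hu0, hu, hug⟩ h ⟨v, hv0, hv, hvh⟩
    have h1 := add_mem (hmul hug hvh) (hinv _ _ (hmul hug hvh))
    have h2 := add_mem (hmul hvh hug) (hinv _ _ (hmul hvh hug))
    rw [hC.symOne_mul_symOne_add_sigmaT hu hv] at h1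
    rw [hC.symOne_mul_symOne_add_sigmaT hv hu, QuadraticMap.polar_comm n v u,
      add_comm (v ⊗ₜ[F] u)] at h2
    exact hinf (smul_ne_zero hF (hC.tmul_add_tmul_sub_ne_zero hF hu hu0 hv0 _)) h1 h2
  set N := Subgroup.closure K
  have hNcomm : ∀ a ∈ N, ∀ b ∈ N, a * b = b * a := by
    have := Subgroup.isMulCommutative_closure hKcomm
    intro a ha b hb
    exact congrArg Subtype.val (mul_comm' (⟨a, ha⟩ : N) ⟨b, hb⟩)
  have hskew : ∀ x ∈ smirnovT F n, x - sigmaT F n x ∈ ⨆ k : N, 𝒯 k := by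
    rw [← hsup]
    intro x hx
    induction hx using Submodule.iSup_induction' with
    | mem g x hx =>
      obtain ⟨u, hu, hxu⟩ := hC.exists_sub_sigmaT_eq_symOne hF (hle g hx)
      rcases eq_or_ne u 0 with rfl | hu0
      · rw [hxu, map_zero]; exact zero_mem _
      · have hg := sub_mem hx (hinv g x hx)
        exact Submodule.mem_iSup_of_mem
          (⟨g, Subgroup.subset_closure ⟨u, hu0, hu, hxu ▸ hg⟩⟩ : N) hg
    | zero => rw [map_zero, sub_zero]; exact zero_mem _
    | add x y _ _ hx hy => rw [map_add, add_sub_add_comm]; exact add_mem hx hy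
  have hT : smirnovT F n ≤ ⨆ k : N, 𝒯 k := by
    refine hC.smirnovT_le hF (fun x hx y hy => mul_mem_iSup_subgroup hmul N hx hy) ?_ ?_
    · intro x hx
      have hmap : (⨆ k : N, 𝒯 k) ≤ (⨆ k : N, 𝒯 k).comap (sigmaT F n) :=
        iSup_le fun k x hx => Submodule.mem_iSup_of_mem k (hinv k x hx)
      exact hmap hx
    · intro u hu
      have h := hskew _ (hC.symOne_mem_smirnovT hu)
      rw [hC.sigmaT_symOne hu, sub_neg_eq_add, ← two_smul F] at h
      exact (Submodule.smul_mem_iff _ hF).1 h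
  have hsupp : ∀ g : G, 𝒯 g ≠ ⊥ → g ∈ N := by
    intro g hg
    by_contra hgN
    refine hg ((hind g).eq_bot_of_le (((hle g).trans hT).trans (iSup_le fun k => ?_)))
    exact le_iSup₂_of_le (k : G) (fun hk => hgN (hk ▸ k.2)) le_rfl
  have hcl : Subgroup.closure {g : G | 𝒯 g ≠ ⊥} ≤ N := (Subgroup.closure_le N).2 hsupp
  exact ⟨fun g h hg hh => hNcomm g (hsupp g hg) h (hsupp h hh),
    fun a ha b hb => hNcomm a (hcl ha) b (hcl hb)⟩
end
end
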